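/- arXiv:1301.4798 — 11 statements merged into one kernel-verified Lean document; each statement's English description precedes it below -/
import Mathlib

section
/- For all reals h > 0, Ā > 0 and c > 0, ∫_0^{Ā} ln(1 + c·a) · (1/h) · e^{−a/h} da = e^{1/(c·h)} · ( E₁(1/(c·h)) − E₁(Ā/h + 1/(c·h)) ) − e^{−Ā/h} · ln(1 + c·Ā). (This is the closed form of the achievable rate R^(T)(h, 1, Ā) of the threshold-switching scheme with one Gaussian random beam, with c = θP/σ², up to the factor 1/ln 2.) -/
/-- Exponential integral `E₁(z) = ∫_1^∞ e^(−z·t) t^(−1) dt`. -/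
noncomputable def expIntE1 (z : ℝ) : ℝ :=
  ∫ t in Set.Ioi (1 : ℝ), Real.exp (-z * t) / t

theorem expIntE1_eq (z : ℝ) (hz : 0 < z) :
    expIntE1 z = ∫ u in Set.Ioi z, Real.exp (-u) / u := by
  have h := MeasureTheory.integral_comp_mul_left_Ioi (fun u => Real.exp (-u) / u) 1 hz
  rw [mul_one, smul_eq_mul] at h
  have h2 : (∫ u in Set.Ioi z, Real.exp (-u) / u)
      = z * ∫ x in Set.Ioi (1:ℝ), Real.exp (-(z * x)) / (z * x) := by
    rw [h]; field_simp
  rw [h2, ← MeasureTheory.integral_const_mul, expIntE1]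
  refine MeasureTheory.setIntegral_congr_fun measurableSet_Ioi ?_
  intro t ht
  have : (0:ℝ) < t := lt_trans one_pos ht
  simp only [neg_mul]
  field_simp

theorem integrable_aux (z : ℝ) (hz : 0 < z) :
    MeasureTheory.IntegrableOn (fun u => Real.exp (-u) / u) (Set.Ioi z) := by
  have h := (integrableOn_exp_neg_Ioi z).const_mul (1 / z)
  refine MeasureTheory.Integrable.mono' h ?_ ?_
  · exact (Measurable.div (by fun_prop) measurable_id).aestronglyMeasurable
  · refine (MeasureTheory.ae_restrict_iff' measurableSet_Ioi).2 (Filter.Eventually.of_forall ?_)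
    intro u hu
    have hu' : z < u := hu
    have : 0 < u := hz.trans hu'
    rw [Real.norm_of_nonneg (by positivity), div_eq_mul_one_div, mul_comm]
    gcongr

theorem expIntE1_sub (x y : ℝ) (hx : 0 < x) (hxy : x ≤ y) :
    expIntE1 x - expIntE1 y = ∫ u in x..y, Real.exp (-u) / u := by
  rw [expIntE1_eq x hx, expIntE1_eq y (hx.trans_le hxy), sub_eq_iff_eq_add]
  exact (intervalIntegral.integral_interval_add_Ioi (integrable_aux x hx)
    (integrable_aux y (hx.trans_le hxy))).symm

/-- Closed form of `∫_0^Ā ln(1 + c·a) (1/h) e^(−a/h) da` (the rate `R^(T)(h,1,Ā)` with one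
Gaussian random beam, up to the factor `1/ln 2`, with `c = θP/σ²`). -/
theorem rate_one_beam_closed_form (h A c : ℝ) (hh : 0 < h) (hA : 0 < A) (hc : 0 < c) :
    ∫ a in (0 : ℝ)..A, Real.log (1 + c * a) * (1 / h) * Real.exp (-a / h) =
      Real.exp (1 / (c * h)) * (expIntE1 (1 / (c * h)) - expIntE1 (A / h + 1 / (c * h)))
        - Real.exp (-A / h) * Real.log (1 + c * A) := by
  have hk : 0 < 1 / (c * h) := by positivity
  have hAh : 0 < A / h := by positivity
  rw [expIntE1_sub _ _ hk (by linarith)]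
  have hcont : ∀ a ∈ Set.uIcc 0 A, 0 < 1 + c * a := by
    intro a ha
    rw [Set.uIcc_of_le hA.le] at ha
    have := ha.1
    positivity
  have key := intervalIntegral.integral_eq_sub_of_hasDerivAt (a := 0) (b := A)
    (f := fun a => Real.exp (1 / (c * h)) *
      (∫ u in (1 / (c * h))..(a / h + 1 / (c * h)), Real.exp (-u) / u)
        - Real.exp (-a / h) * Real.log (1 + c * a))
    (f' := fun a => Real.log (1 + c * a) * (1 / h) * Real.exp (-a / h)) ?_ ?_
  · rw [key]; simp
  · intro a ha
    have h1 := hcont a ha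
    rw [Set.uIcc_of_le hA.le] at ha
    have ha0 := ha.1
    have hpos : 0 < a / h + 1 / (c * h) := by positivity
    have hG : HasDerivAt (fun y => ∫ u in (1 / (c * h))..y, Real.exp (-u) / u)
        (Real.exp (-(a / h + 1 / (c * h))) / (a / h + 1 / (c * h)))
        (a / h + 1 / (c * h)) := by
      apply intervalIntegral.integral_hasDerivAt_right
      · apply ContinuousOn.intervalIntegrable
        apply ContinuousOn.div (by fun_prop) (by fun_prop)
        intro u hu
        exact ((lt_min hk hpos).trans_le hu.1).ne'
      · exact (Measurable.div (by fun_prop) measurable_id).stronglyMeasurable.stronglyMeasurableAtFilter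
      · exact ContinuousAt.div (by fun_prop) (by fun_prop) hpos.ne'
    have hl : HasDerivAt (fun a : ℝ => a / h + 1 / (c * h)) (1 / h) a :=
      ((hasDerivAt_id a).div_const h).add_const _
    have he : HasDerivAt (fun a : ℝ => Real.exp (-a / h)) (Real.exp (-a / h) * (-1 / h)) a :=
      ((hasDerivAt_id a).neg.div_const h).exp
    have hlog : HasDerivAt (fun a : ℝ => Real.log (1 + c * a)) (c * 1 / (1 + c * a)) a :=
      (((hasDerivAt_id a).const_mul c).const_add 1).log h1.ne'
    have hT := ((hG.comp a hl).const_mul (Real.exp (1 / (c * h)))).sub (he.mul hlog)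
    refine HasDerivAt.congr_deriv hT ?_
    have e1 : Real.exp (-(a / h + 1 / (c * h))) = Real.exp (-a / h) / Real.exp (1 / (c * h)) := by
      rw [← Real.exp_sub]; congr 1; ring
    have e2 : a / h + 1 / (c * h) = (1 + c * a) / (c * h) := by field_simp; ring
    rw [e1, e2]
    have := Real.exp_pos (1 / (c * h))
    generalize Real.exp (1 / (c * h)) = K at *
    generalize Real.exp (-a / h) = L at *
    generalize Real.log (1 + c * a) = M at *
    field_simp
    ring
  · apply ContinuousOn.intervalIntegrable
    refine ContinuousOn.mul (ContinuousOn.mul (ContinuousOn.log (by fun_prop) ?_) (by fun_prop)) (by fun_prop)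
    intro a ha
    exact (hcont a ha).ne'
end

section
/- Fix an integer N ≥ 1 and reals h > 0, Ā > 0, and let f(a) = ((N/h)^N / Γ(N)) a^{N−1} e^{−(N/h)a} be the Gamma density with shape N and mean h. Then ∫_0^{Ā} |ln(a)| f(a) da is finite, and lim_{c→∞} ( ∫_0^{Ā} ln(1 + c·a) f(a) da − ln(c) · ∫_0^{Ā} f(a) da ) = ∫_0^{Ā} ln(a) f(a) da. (This is the high-power approximation (16) of the achievable rate of the threshold-switching scheme, which becomes exact in the limit.) -/
/-- High-power approximation of the threshold-switching rate: with `f` the Gamma density of shape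
`N` and mean `h`, the weighted log-moment `∫_0^Ā |ln a| f(a) da` is finite and
`∫_0^Ā ln(1+c·a) f(a) da − ln(c) ∫_0^Ā f(a) da → ∫_0^Ā ln(a) f(a) da` as `c → ∞`. -/
theorem high_power_rate_approximation (N : ℕ) (hN : 1 ≤ N) (h A : ℝ) (hh : 0 < h) (hA : 0 < A)
    (f : ℝ → ℝ)
    (hf : ∀ a : ℝ,
      f a = (((N : ℝ) / h) ^ N / Real.Gamma N) * a ^ (N - 1) * Real.exp (-((N : ℝ) / h) * a)) :
    MeasureTheory.IntegrableOn (fun a => |Real.log a| * f a) (Set.Ioc 0 A) ∧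
    Filter.Tendsto
      (fun c : ℝ =>
        (∫ a in Set.Ioc (0 : ℝ) A, Real.log (1 + c * a) * f a) -
          Real.log c * ∫ a in Set.Ioc (0 : ℝ) A, f a)
      Filter.atTop
      (nhds (∫ a in Set.Ioc (0 : ℝ) A, Real.log a * f a)) := by
  have hfc : Continuous f := by
    rw [funext hf]; fun_prop
  have hlog : MeasureTheory.IntegrableOn (fun a => Real.log a * f a) (Set.Ioc 0 A) := by
    have h1 : IntervalIntegrable Real.log MeasureTheory.volume 0 A :=
      intervalIntegral.intervalIntegrable_log'
    exact (intervalIntegrable_iff_integrableOn_Ioc_of_le hA.le).1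
      (h1.mul_continuousOn hfc.continuousOn)
  have hfi : MeasureTheory.IntegrableOn f (Set.Ioc 0 A) := hfc.integrableOn_Ioc
  have hf0 : ∀ a ∈ Set.Ioc (0 : ℝ) A, 0 ≤ f a := by
    intro a ha
    have hG : 0 < Real.Gamma N := Real.Gamma_pos_of_pos (by exact_mod_cast hN)
    have ha0 : 0 < a := ha.1
    rw [hf]; positivity
  have habs : MeasureTheory.IntegrableOn (fun a => |Real.log a| * f a) (Set.Ioc 0 A) := by
    refine MeasureTheory.IntegrableOn.congr_fun hlog.abs ?_ measurableSet_Ioc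
    intro a ha
    simp only [abs_mul, abs_of_nonneg (hf0 a ha)]
  refine ⟨habs, ?_⟩
  have key : Filter.Tendsto
      (fun c : ℝ => ∫ a in Set.Ioc (0 : ℝ) A, Real.log (a + c⁻¹) * f a) Filter.atTop
      (nhds (∫ a in Set.Ioc (0 : ℝ) A, Real.log a * f a)) := by
    refine MeasureTheory.tendsto_integral_filter_of_dominated_convergence
      (fun a => |Real.log a| * f a + Real.log (1 + A) * f a) ?_ ?_ ?_ ?_
    · refine Filter.Eventually.of_forall fun c => ?_
      have : Measurable (fun a => Real.log (a + c⁻¹) * f a) :=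
        (Real.measurable_log.comp (measurable_id.add_const _)).mul hfc.measurable
      exact this.aestronglyMeasurable
    · filter_upwards [Filter.eventually_ge_atTop (1 : ℝ)] with c hc
      refine (MeasureTheory.ae_restrict_iff' measurableSet_Ioc).2
        (Filter.Eventually.of_forall fun a ha => ?_)
      have ha0 : 0 < a := ha.1
      have hc0 : 0 < c⁻¹ := by positivity
      have hc1 : c⁻¹ ≤ 1 := inv_le_one_of_one_le₀ hc
      have l1 : Real.log a ≤ Real.log (a + c⁻¹) := Real.log_le_log ha0 (by linarith)
      have l2 : Real.log (a + c⁻¹) ≤ Real.log (1 + A) :=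
        Real.log_le_log (by linarith) (by linarith [ha.2])
      have l3 : 0 ≤ Real.log (1 + A) := Real.log_nonneg (by linarith)
      rw [Real.norm_eq_abs, abs_mul, abs_of_nonneg (hf0 a ha), ← add_mul]
      refine mul_le_mul_of_nonneg_right ?_ (hf0 a ha)
      refine abs_le.2 ⟨?_, ?_⟩
      · linarith [neg_abs_le (Real.log a)]
      · linarith [abs_nonneg (Real.log a)]
    · exact habs.add (hfi.const_mul _)
    · refine (MeasureTheory.ae_restrict_iff' measurableSet_Ioc).2
        (Filter.Eventually.of_forall fun a ha => ?_)
      have ha0 : a ≠ 0 := ha.1.ne'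
      have h1 : Filter.Tendsto (fun c : ℝ => a + c⁻¹) Filter.atTop (nhds a) := by
        simpa using tendsto_inv_atTop_zero.const_add a
      exact (h1.log ha0).mul_const _
  refine key.congr' ?_
  filter_upwards [Filter.eventually_ge_atTop (1 : ℝ)] with c hc
  have hc0 : 0 < c := by linarith
  have hint : MeasureTheory.IntegrableOn (fun a => Real.log (1 + c * a) * f a) (Set.Ioc 0 A) := by
    have hco : ContinuousOn (fun a => Real.log (1 + c * a) * f a) (Set.Icc 0 A) := by
      refine ContinuousOn.mul (ContinuousOn.log (by fun_prop) ?_) hfc.continuousOn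
      intro a ha
      have := ha.1
      positivity
    exact hco.integrableOn_Icc.mono_set Set.Ioc_subset_Icc_self
  rw [← MeasureTheory.integral_const_mul, ← MeasureTheory.integral_sub hint (hfi.const_mul _)]
  refine MeasureTheory.setIntegral_congr_fun measurableSet_Ioc fun a ha => ?_
  have ha0 : 0 < a := ha.1
  have e : 1 + c * a = c * (a + c⁻¹) := by field_simp; ring
  have e2 : Real.log (1 + c * a) = Real.log c + Real.log (a + c⁻¹) := by
    rw [e, Real.log_mul hc0.ne' (by positivity)]
  simp only [e2]
  ring
end

section
/- Fix integers N ≥ 1 and Nt ≥ 1, and reals Ā > 0 and c₀ > 0. Define R(P) = ∫_0^∞ ( ∫_0^{Ā} ln(1 + c₀·P·a) · f_{A|H}(a|h) da ) f_H(h) dh for P > 0, where f_{A|H}(a|h) = ((N/h)^N / Γ(N)) a^{N−1} e^{−(N/h)a} and f_H(h) = (Nt^{Nt} / Γ(Nt)) h^{Nt−1} e^{−Nt·h}. Then lim_{P→∞} R(P) / ln(P) = ∫_0^∞ ( 1 − Γ(N, N·Ā/h)/Γ(N) ) f_H(h) dh. (This is Proposition 3.1: the pre-log scaling factor of the achievable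 average rate of threshold switching with N Gaussian random beams over the i.i.d. Rayleigh fading MISO channel equals the unconditional CDF F_A^{(N)}(Ā).) -/
/-- Upper incomplete Gamma function `Γ(α, x) = ∫_x^∞ t^(α−1) e^(−t) dt`. -/
noncomputable def uiGamma (α x : ℝ) : ℝ :=
  ∫ t in Set.Ioi x, t ^ (α - 1) * Real.exp (-t)


open MeasureTheory Filter Topology Set

lemma aux_integrable (N : ℕ) (hN : 1 ≤ N) :
    IntegrableOn (fun t : ℝ => t ^ ((N : ℝ) - 1) * Real.exp (-t)) (Ioi 0) := by
  have h := Real.GammaIntegral_convergent (s := (N : ℝ)) (by positivity)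
  refine h.congr_fun (fun x _ => by simp only; ring) measurableSet_Ioi

lemma aux_cdf (N : ℕ) (hN : 1 ≤ N) (A h : ℝ) (hA : 0 < A) (hh : 0 < h) :
    ∫ a in Ioc (0 : ℝ) A, (((N : ℝ) / h) ^ N / Real.Gamma N) * a ^ (N - 1)
        * Real.exp (-((N : ℝ) / h) * a)
      = 1 - uiGamma N ((N : ℝ) * A / h) / Real.Gamma N := by
  have hN0 : (0 : ℝ) < N := by exact_mod_cast hN
  have hG : 0 < Real.Gamma N := Real.Gamma_pos_of_pos hN0
  have hc : 0 < (N : ℝ) / h := by positivity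
  set c := (N : ℝ) / h with hcdef
  have e1 : (N : ℝ) * A / h = c * A := by rw [hcdef]; ring
  rw [e1]
  have hcA : 0 < c * A := by positivity
  have e2 : ∀ a : ℝ, (c ^ N / Real.Gamma N) * a ^ (N - 1) * Real.exp (-c * a)
      = (c / Real.Gamma N) * (fun t : ℝ => t ^ ((N : ℝ) - 1) * Real.exp (-t)) (c * a) := by
    intro a
    have : (N : ℝ) - 1 = ((N - 1 : ℕ) : ℝ) := by push_cast [hN]; ring
    simp only [this, Real.rpow_natCast]
    obtain ⟨k, rfl⟩ : ∃ k, N = k + 1 := ⟨N - 1, by omega⟩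
    simp only [Nat.add_sub_cancel, mul_pow, pow_succ, neg_mul]
    ring
  simp_rw [e2]
  rw [← intervalIntegral.integral_of_le hA.le, intervalIntegral.integral_const_mul,
    intervalIntegral.integral_comp_mul_left
      (fun t : ℝ => t ^ ((N : ℝ) - 1) * Real.exp (-t)) hc.ne', mul_zero,
    intervalIntegral.integral_of_le hcA.le, smul_eq_mul]
  have hint := aux_integrable N hN
  have hsplit : Real.Gamma N = (∫ t in Ioc 0 (c * A), t ^ ((N : ℝ) - 1) * Real.exp (-t))
      + uiGamma N (c * A) := by
    rw [uiGamma, ← setIntegral_union (Ioc_disjoint_Ioi le_rfl) measurableSet_Ioi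
      (hint.mono_set Ioc_subset_Ioi_self) (hint.mono_set (Ioi_subset_Ioi hcA.le)),
      Ioc_union_Ioi_eq_Ioi hcA.le, Real.Gamma_eq_integral hN0]
    simp only [mul_comm]
  have e3 : (∫ t in Ioc 0 (c * A), t ^ ((N : ℝ) - 1) * Real.exp (-t))
      = Real.Gamma N - uiGamma N (c * A) := by linarith
  rw [e3]
  field_simp

lemma aux_fH (Nt : ℕ) (hNt : 1 ≤ Nt) :
    IntegrableOn (fun h : ℝ => ((Nt : ℝ) ^ Nt / Real.Gamma Nt) * h ^ (Nt - 1)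
      * Real.exp (-(Nt : ℝ) * h)) (Ioi 0) := by
  have hN0 : (0 : ℝ) < Nt := by exact_mod_cast hNt
  have h := integrableOn_rpow_mul_exp_neg_mul_rpow (p := 1) (s := ((Nt - 1 : ℕ) : ℝ)) (b := Nt)
    (by have : (0 : ℝ) ≤ ((Nt - 1 : ℕ) : ℝ) := by positivity
        linarith) one_pos hN0
  have h2 := Integrable.const_mul h ((Nt : ℝ) ^ Nt / Real.Gamma Nt)
  simp only [Real.rpow_natCast, Real.rpow_one] at h2
  refine h2.congr (Eventually.of_forall fun x => ?_)
  simp only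
  ring

lemma aux_log_bound (A c₀ P a : ℝ) (hc₀ : 0 < c₀) (hP : Real.exp 1 ≤ P)
    (ha : 0 < a) (haA : a ≤ A) :
    0 ≤ Real.log (1 + c₀ * P * a) / Real.log P ∧
    Real.log (1 + c₀ * P * a) / Real.log P ≤ Real.log (1 + c₀ * A) + 1 := by
  have hP1 : 1 ≤ P := le_trans (by have := Real.add_one_le_exp (1 : ℝ); linarith) hP
  have hP0 : 0 < P := by linarith
  have hlog : 1 ≤ Real.log P := (Real.le_log_iff_exp_le hP0).2 hP
  have hA : 0 < A := by linarith
  have hpos : 0 < c₀ * P * a := by positivity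
  refine ⟨div_nonneg (Real.log_nonneg (by linarith)) (by linarith), ?_⟩
  rw [div_le_iff₀ (by linarith)]
  have h1 : 1 + c₀ * P * a ≤ (1 + c₀ * A) * P := by
    have : c₀ * P * a ≤ c₀ * P * A := by gcongr
    nlinarith
  have h2 := Real.log_le_log (by linarith) h1
  rw [Real.log_mul (by positivity) hP0.ne'] at h2
  have h3 : 0 ≤ Real.log (1 + c₀ * A) := Real.log_nonneg (by nlinarith)
  nlinarith

lemma aux_log_tendsto (c₀ a : ℝ) (hc₀ : 0 < c₀) (ha : 0 < a) :
    Tendsto (fun P : ℝ => Real.log (1 + c₀ * P * a) / Real.log P) atTop (𝓝 1) := by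
  have h1 : Tendsto (fun P : ℝ => Real.log (P⁻¹ + c₀ * a) / Real.log P + 1) atTop (𝓝 1) := by
    have h2 : Tendsto (fun P : ℝ => Real.log (P⁻¹ + c₀ * a)) atTop
        (𝓝 (Real.log (0 + c₀ * a))) :=
      (tendsto_inv_atTop_zero.add_const _).log (by positivity)
    simpa using (h2.div_atTop Real.tendsto_log_atTop).add_const 1
  refine h1.congr' ?_
  filter_upwards [eventually_gt_atTop 1] with P hP
  have hP0 : 0 < P := by linarith
  have hl := Real.log_pos hP
  have : 1 + c₀ * P * a = (P⁻¹ + c₀ * a) * P := by field_simp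
  rw [this, Real.log_mul (by positivity) hP0.ne']
  field_simp

/-- Proposition 3.1: the pre-log scaling factor of the achievable average rate of threshold
switching with `N` Gaussian random beams over the i.i.d. Rayleigh fading MISO channel equals the
unconditional CDF `F_A^(N)(Ā)`. -/
theorem rate_prelog_scaling (N Nt : ℕ) (hN : 1 ≤ N) (hNt : 1 ≤ Nt)
    (A c₀ : ℝ) (hA : 0 < A) (hc₀ : 0 < c₀)
    (fAH : ℝ → ℝ → ℝ) (fH : ℝ → ℝ)
    (hfAH : ∀ a h : ℝ,
      fAH a h = (((N : ℝ) / h) ^ N / Real.Gamma N) * a ^ (N - 1) * Real.exp (-((N : ℝ) / h) * a))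
    (hfH : ∀ h : ℝ,
      fH h = ((Nt : ℝ) ^ Nt / Real.Gamma Nt) * h ^ (Nt - 1) * Real.exp (-(Nt : ℝ) * h))
    (R : ℝ → ℝ)
    (hR : ∀ P : ℝ, R P = ∫ h in Set.Ioi (0 : ℝ),
      (∫ a in Set.Ioc (0 : ℝ) A, Real.log (1 + c₀ * P * a) * fAH a h) * fH h) :
    Filter.Tendsto (fun P : ℝ => R P / Real.log P) Filter.atTop
      (nhds (∫ h in Set.Ioi (0 : ℝ),
        (1 - uiGamma N ((N : ℝ) * A / h) / Real.Gamma N) * fH h)) := by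
  have hN0 : (0 : ℝ) < N := by exact_mod_cast hN
  have hNt0 : (0 : ℝ) < Nt := by exact_mod_cast hNt
  have hG : 0 < Real.Gamma N := Real.Gamma_pos_of_pos hN0
  have hGt : 0 < Real.Gamma Nt := Real.Gamma_pos_of_pos hNt0
  have hcdf : ∀ h : ℝ, 0 < h → ∫ a in Ioc (0 : ℝ) A, fAH a h
      = 1 - uiGamma N ((N : ℝ) * A / h) / Real.Gamma N := by
    intro h hh
    simp_rw [hfAH]
    exact aux_cdf N hN A h hA hh
  have hcdf1 : ∀ h : ℝ, 0 < h → ∫ a in Ioc (0 : ℝ) A, fAH a h ≤ 1 := by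
    intro h hh
    rw [hcdf h hh]
    have : 0 ≤ uiGamma N ((N : ℝ) * A / h) := by
      refine setIntegral_nonneg measurableSet_Ioi fun t ht => ?_
      have : 0 < t := lt_trans (by positivity) (mem_Ioi.1 ht)
      positivity
    have := div_nonneg this hG.le
    linarith
  have hf0 : ∀ a h : ℝ, 0 < a → 0 < h → 0 ≤ fAH a h := by
    intro a h ha hh
    rw [hfAH]; positivity
  have hfH0 : ∀ h : ℝ, 0 < h → 0 ≤ fH h := by
    intro h hh
    rw [hfH]; positivity
  have hfint : ∀ h : ℝ, IntegrableOn (fun a => fAH a h) (Ioc 0 A) := by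
    intro h
    have : Continuous (fun a => fAH a h) := by
      simp_rw [hfAH]; fun_prop
    exact this.integrableOn_Ioc
  have hfHint : IntegrableOn fH (Ioi 0) := by
    have := aux_fH Nt hNt
    rwa [← (funext hfH : fH = _)] at this
  have hfmeas : Measurable (fun p : ℝ × ℝ => fAH p.2 p.1) := by
    simp_rw [hfAH]; fun_prop
  set C := Real.log (1 + c₀ * A) + 1 with hC
  let g : ℝ → ℝ → ℝ := fun P h =>
    ∫ a in Ioc (0 : ℝ) A, Real.log (1 + c₀ * P * a) / Real.log P * fAH a h
  have hgm : ∀ P, StronglyMeasurable (g P) := by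
    intro P
    have : StronglyMeasurable (fun p : ℝ × ℝ =>
        Real.log (1 + c₀ * P * p.2) / Real.log P * fAH p.2 p.1) := by
      apply Measurable.stronglyMeasurable
      refine Measurable.mul ?_ hfmeas
      fun_prop
    exact this.integral_prod_right'
  have hbd : ∀ P h a, Real.exp 1 ≤ P → 0 < h → a ∈ Ioc (0 : ℝ) A →
      ‖Real.log (1 + c₀ * P * a) / Real.log P * fAH a h‖ ≤ C * fAH a h := by
    intro P h a hP hh ha
    obtain ⟨h1, h2⟩ := aux_log_bound A c₀ P a hc₀ hP ha.1 ha.2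
    have h3 := hf0 a h ha.1 hh
    rw [Real.norm_of_nonneg (mul_nonneg h1 h3)]
    exact mul_le_mul_of_nonneg_right h2 h3
  have hC0 : 0 ≤ C := by
    have : 0 ≤ Real.log (1 + c₀ * A) := Real.log_nonneg (by nlinarith)
    linarith
  have hgt : ∀ h : ℝ, 0 < h → Tendsto (fun P => g P h) atTop
      (𝓝 (1 - uiGamma N ((N : ℝ) * A / h) / Real.Gamma N)) := by
    intro h hh
    rw [← hcdf h hh]
    refine tendsto_integral_filter_of_dominated_convergence (fun a => C * fAH a h) ?_ ?_ ?_ ?_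
    · refine Eventually.of_forall fun P => Measurable.aestronglyMeasurable ?_
      simp_rw [hfAH]; fun_prop
    · filter_upwards [eventually_ge_atTop (Real.exp 1)] with P hP
      refine (ae_restrict_iff' measurableSet_Ioc).2 (Eventually.of_forall fun a ha => ?_)
      exact hbd P h a hP hh ha
    · exact (hfint h).const_mul C
    · refine (ae_restrict_iff' measurableSet_Ioc).2 (Eventually.of_forall fun a ha => ?_)
      simpa using (aux_log_tendsto c₀ a hc₀ ha.1).mul_const (fAH a h)
  have hgb : ∀ P h, Real.exp 1 ≤ P → 0 < h → ‖g P h‖ ≤ C := by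
    intro P h hP hh
    have h1 : ‖g P h‖ ≤ ∫ a in Ioc (0 : ℝ) A, C * fAH a h := by
      refine norm_integral_le_of_norm_le ((hfint h).const_mul C) ?_
      refine (ae_restrict_iff' measurableSet_Ioc).2 (Eventually.of_forall fun a ha => ?_)
      exact hbd P h a hP hh ha
    rw [integral_const_mul] at h1
    have := mul_le_mul_of_nonneg_left (hcdf1 h hh) hC0
    linarith
  have hRg : ∀ P, R P / Real.log P = ∫ h in Ioi (0 : ℝ), g P h * fH h := by
    intro P
    rw [hR, ← integral_div]
    congr 1
    ext h
    simp only [g]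
    rw [mul_div_right_comm, ← integral_div]
    congr 2
    ext a
    ring
  simp_rw [hRg]
  refine tendsto_integral_filter_of_dominated_convergence (fun h => C * fH h) ?_ ?_ ?_ ?_
  · exact Eventually.of_forall fun P =>
      (hgm P).aestronglyMeasurable.mul hfHint.aestronglyMeasurable
  · filter_upwards [eventually_ge_atTop (Real.exp 1)] with P hP
    refine (ae_restrict_iff' measurableSet_Ioi).2 (Eventually.of_forall fun h hh => ?_)
    rw [norm_mul, Real.norm_of_nonneg (hfH0 h hh)]
    exact mul_le_mul_of_nonneg_right (hgb P h hP hh) (hfH0 h hh)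
  · exact hfHint.const_mul C
  · refine (ae_restrict_iff' measurableSet_Ioi).2 (Eventually.of_forall fun h hh => ?_)
    exact (hgt h hh).mul_const (fH h)
end

section
/- For integers N, Nt with 1 ≤ N ≤ Nt and every real Ā with 0 < Ā < ∞, Δ^(T)(N, Ā) + Π^(T)(N, Ā) > 1, where Δ^(T)(N, Ā) = ∫_0^∞ ( 1 − Γ(N, N·Ā/h)/Γ(N) ) f_H(h) dh and Π^(T)(N, Ā) = ∫_0^∞ h · ( Γ(N+1, N·Ā/h)/Γ(N+1) ) f_H(h) dh, with f_H(h) = (Nt^{Nt}/Γ(Nt)) h^{Nt−1} e^{−Nt·h}. Equivalently (first part of Theorem 3.1): if 0 < τ < 1 and Π^(T)(N, Ā) = 1 − τ, then the rate scaling factor Δ^(T)(N, Ā) strictly exceeds the rate scaling factor τ of the periodic-switching scheme with the same power scaling factor. -/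
open MeasureTheory Set

lemma ui_int {α : ℝ} (hα : 0 < α) :
    IntegrableOn (fun t : ℝ => t ^ (α - 1) * Real.exp (-t)) (Ioi 0) := by
  refine (Real.GammaIntegral_convergent hα).congr_fun (fun t _ => mul_comm _ _) measurableSet_Ioi

lemma ui_zero {α : ℝ} (hα : 0 < α) : uiGamma α 0 = Real.Gamma α := by
  rw [Real.Gamma_eq_integral hα, uiGamma]
  simp_rw [mul_comm]

lemma ui_nonneg {α x : ℝ} (hx : 0 ≤ x) : 0 ≤ uiGamma α x :=
  setIntegral_nonneg measurableSet_Ioi fun t ht => by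
    have : 0 < t := lt_of_le_of_lt hx ht
    positivity

lemma ui_anti {α x y : ℝ} (hα : 0 < α) (hx : 0 ≤ x) (hxy : x ≤ y) :
    uiGamma α y ≤ uiGamma α x := by
  refine setIntegral_mono_set ((ui_int hα).mono_set (Ioi_subset_Ioi hx)) ?_
    (Ioi_subset_Ioi hxy).eventuallyLE
  filter_upwards [ae_restrict_mem measurableSet_Ioi] with t ht
  have : 0 < t := lt_of_le_of_lt hx ht
  simp only [Pi.zero_apply]
  positivity

lemma setInt_pos {s : Set ℝ} (hs : MeasurableSet s) (hv : 0 < volume s) {f : ℝ → ℝ}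
    (hf : IntegrableOn f s) (hp : ∀ x ∈ s, 0 < f x) : 0 < ∫ x in s, f x := by
  rw [setIntegral_pos_iff_support_of_nonneg_ae _ hf]
  · refine lt_of_lt_of_le hv (measure_mono fun x hx => ⟨(hp x hx).ne', hx⟩)
  · filter_upwards [ae_restrict_mem hs] with t ht using (hp t ht).le

lemma setInt_lt {f g : ℝ → ℝ} (hf : IntegrableOn f (Ioi 0)) (hg : IntegrableOn g (Ioi 0))
    (hp : ∀ x ∈ Ioi (0:ℝ), f x < g x) : ∫ x in Ioi (0:ℝ), f x < ∫ x in Ioi (0:ℝ), g x := by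
  rw [← sub_pos, ← integral_sub hg hf]
  exact setInt_pos measurableSet_Ioi (by simp) (hg.sub hf) fun x hx => sub_pos.2 (hp x hx)

lemma ui_succ_eq {n h x : ℝ} (hn : 0 < n) (hx : 0 ≤ x) :
    h * (uiGamma (n + 1) x / Real.Gamma (n + 1)) - uiGamma n x / Real.Gamma n
      = (∫ t in Ioi x, (h * t / n - 1) * (t ^ (n - 1) * Real.exp (-t))) / Real.Gamma n := by
  have i1 := (ui_int (α := n + 1) (by linarith)).mono_set (Ioi_subset_Ioi hx)
  have i2 := (ui_int hn).mono_set (Ioi_subset_Ioi hx)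
  have e : ∫ t in Ioi x, (h * t / n - 1) * (t ^ (n - 1) * Real.exp (-t))
      = h / n * uiGamma (n + 1) x - uiGamma n x := by
    rw [uiGamma, uiGamma, ← integral_const_mul, ← integral_sub (i1.const_mul _) i2]
    refine setIntegral_congr_fun measurableSet_Ioi fun t ht => ?_
    have ht0 : 0 < t := lt_of_le_of_lt hx ht
    have : t ^ (n + 1 - 1) = t ^ (n - 1) * t := by
      rw [← Real.rpow_add_one ht0.ne']; congr 1; ring
    simp only [this]
    ring
  have hG := Real.Gamma_pos_of_pos hn
  rw [e, Real.Gamma_add_one hn.ne']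
  field_simp

lemma int_lin {n : ℝ} (h : ℝ) (hn : 0 < n) :
    IntegrableOn (fun t : ℝ => (h * t / n - 1) * (t ^ (n - 1) * Real.exp (-t))) (Ioi 0) := by
  have i1 := ui_int (α := n + 1) (by linarith)
  have i2 : IntegrableOn (fun t : ℝ => h / n * (t ^ (n + 1 - 1) * Real.exp (-t))
      - t ^ (n - 1) * Real.exp (-t)) (Ioi 0) := (i1.const_mul (h / n)).sub (ui_int hn)
  refine i2.congr_fun (fun t ht => ?_) measurableSet_Ioi
  have ht0 : 0 < t := ht
  have : t ^ (n + 1 - 1) = t ^ (n - 1) * t := by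
    rw [← Real.rpow_add_one ht0.ne']; congr 1; ring
  simp only [this]
  ring

lemma pt_big {n h A : ℝ} (hn : 0 < n) (hh : 0 < h) (hA : 1 ≤ A) :
    0 < h * (uiGamma (n + 1) (n * A / h) / Real.Gamma (n + 1))
      - uiGamma n (n * A / h) / Real.Gamma n := by
  have hx : 0 < n * A / h := by positivity
  rw [ui_succ_eq hn hx.le]
  refine div_pos (setInt_pos measurableSet_Ioi (by simp)
    ((int_lin h hn).mono_set (Ioi_subset_Ioi hx.le)) fun t ht => ?_) (Real.Gamma_pos_of_pos hn)
  have ht' : n * A / h < t := ht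
  have ht0 : 0 < t := hx.trans ht'
  rw [div_lt_iff₀ hh] at ht'
  have : 1 < h * t / n := by
    rw [lt_div_iff₀ hn]; nlinarith
  have : 0 < h * t / n - 1 := by linarith
  positivity

lemma pt_small {n h A : ℝ} (hn : 0 < n) (hh : 0 < h) (hA0 : 0 < A) (hA : A < 1) :
    h - 1 < h * (uiGamma (n + 1) (n * A / h) / Real.Gamma (n + 1))
      - uiGamma n (n * A / h) / Real.Gamma n := by
  have hx : 0 < n * A / h := by positivity
  have hG := Real.Gamma_pos_of_pos hn
  have hG1 := Real.Gamma_pos_of_pos (show 0 < n + 1 by linarith)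
  have e0 := ui_succ_eq (h := h) hn le_rfl
  rw [ui_zero hn, ui_zero (by linarith), div_self hG.ne', div_self hG1.ne', mul_one] at e0
  rw [ui_succ_eq hn hx.le, e0]
  refine div_lt_div_of_pos_right ?_ hG
  have hI := int_lin h hn
  rw [← Ioc_union_Ioi_eq_Ioi hx.le, setIntegral_union (Ioc_disjoint_Ioi le_rfl) measurableSet_Ioi
    (hI.mono_set Ioc_subset_Ioi_self) (hI.mono_set (Ioi_subset_Ioi hx.le))]
  have := setInt_pos (s := Ioc 0 (n * A / h)) measurableSet_Ioc (by simpa using hx)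
    (hI.mono_set Ioc_subset_Ioi_self).neg (fun t ht => by
      have ht0 := ht.1
      have ht' := ht.2
      rw [le_div_iff₀ hh] at ht'
      have : h * t / n < 1 := by
        rw [div_lt_iff₀ hn]; nlinarith
      have : 0 < 1 - h * t / n := by linarith
      have : 0 < (1 - h * t / n) * (t ^ (n - 1) * Real.exp (-t)) := by positivity
      simp only [Pi.neg_apply]
      linarith)
  simp only [Pi.neg_apply, integral_neg] at this
  linarith

lemma ui_aem {α c : ℝ} (hα : 0 < α) (hc : 0 < c) :
    AEStronglyMeasurable (fun h : ℝ => uiGamma α (c / h)) (volume.restrict (Ioi 0)) := by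
  refine (aemeasurable_restrict_of_monotoneOn measurableSet_Ioi ?_).aestronglyMeasurable
  intro a ha b hb hab
  have ha' : 0 < a := ha
  have hb' : 0 < b := hb
  exact ui_anti hα (by positivity) (by gcongr)

lemma ui_mul_int {α c : ℝ} (hα : 0 < α) (hc : 0 < c) {g : ℝ → ℝ} (hg : IntegrableOn g (Ioi 0)) :
    IntegrableOn (fun h => uiGamma α (c / h) / Real.Gamma α * g h) (Ioi 0) := by
  refine Integrable.bdd_mul (c := 1) hg ((ui_aem hα hc).aemeasurable.div_const _).aestronglyMeasurable ?_
  filter_upwards [ae_restrict_mem measurableSet_Ioi] with t ht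
  have ht' : 0 < t := ht
  have h0 : 0 ≤ c / t := by positivity
  have hG := Real.Gamma_pos_of_pos hα
  rw [Real.norm_of_nonneg (div_nonneg (ui_nonneg h0) hG.le), div_le_one hG, ← ui_zero hα]
  exact ui_anti hα le_rfl h0

lemma fH_facts (M : ℕ) (hM : 1 ≤ M) (f : ℝ → ℝ)
    (hf : ∀ h : ℝ, f h = ((M : ℝ) ^ M / Real.Gamma M) * h ^ (M - 1) * Real.exp (-(M : ℝ) * h)) :
    IntegrableOn f (Ioi 0) ∧ IntegrableOn (fun h => h * f h) (Ioi 0) ∧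
    (∫ h in Ioi (0:ℝ), f h) = 1 ∧ (∫ h in Ioi (0:ℝ), h * f h) = 1 := by
  have hM0 : (0:ℝ) < M := by exact_mod_cast hM
  have hG := Real.Gamma_pos_of_pos hM0
  have v1 : (∫ h in Ioi (0:ℝ), f h) = 1 := by
    have := Real.integral_rpow_mul_exp_neg_mul_Ioi hM0 hM0
    have e : ∀ h ∈ Ioi (0:ℝ), f h = ((M : ℝ) ^ M / Real.Gamma M) *
        (h ^ ((M:ℝ) - 1) * Real.exp (-((M:ℝ) * h))) := by
      intro h hh
      have : (M:ℝ) - 1 = ((M - 1 : ℕ) : ℝ) := by push_cast [hM]; ring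
      rw [hf, this, Real.rpow_natCast, neg_mul, mul_assoc]
    rw [setIntegral_congr_fun measurableSet_Ioi e, integral_const_mul, this, Real.rpow_natCast]
    rw [one_div, inv_pow]
    field_simp
  have v2 : (∫ h in Ioi (0:ℝ), h * f h) = 1 := by
    have := Real.integral_rpow_mul_exp_neg_mul_Ioi (a := (M:ℝ) + 1) (by linarith) hM0
    have e : ∀ h ∈ Ioi (0:ℝ), h * f h = ((M : ℝ) ^ M / Real.Gamma M) *
        (h ^ ((M:ℝ) + 1 - 1) * Real.exp (-((M:ℝ) * h))) := by
      intro h hh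
      have : h ^ M = h ^ (M - 1) * h := by rw [← pow_succ, Nat.sub_add_cancel hM]
      rw [hf, add_sub_cancel_right, Real.rpow_natCast, neg_mul, this]
      ring
    rw [setIntegral_congr_fun measurableSet_Ioi e, integral_const_mul, this,
      Real.Gamma_add_one hM0.ne', ← Nat.cast_add_one, Real.rpow_natCast]
    rw [one_div, inv_pow]
    field_simp
    ring
  refine ⟨?_, ?_, v1, v2⟩
  · by_contra hc
    rw [integral_undef hc] at v1
    exact zero_ne_one v1
  · by_contra hc
    rw [integral_undef hc] at v2
    exact zero_ne_one v2

/-- First part of Theorem 3.1: the rate and power scaling factors of threshold switching satisfy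
`Δ^(T)(N, Ā) + Π^(T)(N, Ā) > 1`; equivalently, if `Π^(T)(N, Ā) = 1 − τ` with `0 < τ < 1`, then
`Δ^(T)(N, Ā) > τ`, the rate scaling factor of periodic switching with the same power scaling
factor. -/
theorem threshold_beats_periodic_scaling (N Nt : ℕ) (hN : 1 ≤ N) (hNNt : N ≤ Nt)
    (A : ℝ) (hA : 0 < A)
    (fH : ℝ → ℝ)
    (hfH : ∀ h : ℝ,
      fH h = ((Nt : ℝ) ^ Nt / Real.Gamma Nt) * h ^ (Nt - 1) * Real.exp (-(Nt : ℝ) * h))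
    (Δ Pi : ℝ)
    (hΔ : Δ = ∫ h in Set.Ioi (0 : ℝ), (1 - uiGamma N ((N : ℝ) * A / h) / Real.Gamma N) * fH h)
    (hPi : Pi = ∫ h in Set.Ioi (0 : ℝ),
      h * (uiGamma ((N : ℝ) + 1) ((N : ℝ) * A / h) / Real.Gamma ((N : ℝ) + 1)) * fH h) :
    1 < Δ + Pi ∧ ∀ τ : ℝ, 0 < τ → τ < 1 → Pi = 1 - τ → τ < Δ := by
  have n0 : (0:ℝ) < N := by exact_mod_cast hN
  have hM : 1 ≤ Nt := hN.trans hNNt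
  obtain ⟨i1, i2, v1, v2⟩ := fH_facts Nt hM fH hfH
  have hfpos : ∀ h ∈ Ioi (0:ℝ), 0 < fH h := by
    intro h hh
    have hh' : 0 < h := hh
    have hM0 : (0:ℝ) < Nt := by exact_mod_cast hM
    have hG := Real.Gamma_pos_of_pos hM0
    rw [hfH]
    positivity
  have hc : 0 < (N:ℝ) * A := by positivity
  have j1 := ui_mul_int n0 hc i1
  have j2 := ui_mul_int (α := (N:ℝ) + 1) (by linarith) hc i2
  have k1 : IntegrableOn (fun h => (1 - uiGamma N ((N : ℝ) * A / h) / Real.Gamma N) * fH h)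
      (Ioi 0) :=
    IntegrableOn.congr_fun (i1.sub j1) (fun h _ => by simp only [_root_.Pi.sub_apply]; ring)
      measurableSet_Ioi
  have k2 : IntegrableOn (fun h =>
      h * (uiGamma ((N : ℝ) + 1) ((N : ℝ) * A / h) / Real.Gamma ((N : ℝ) + 1)) * fH h) (Ioi 0) :=
    j2.congr_fun (fun h _ => by ring) measurableSet_Ioi
  have main : 1 < Δ + Pi := by
    rw [hΔ, hPi, ← integral_add k1 k2]
    rcases le_or_gt 1 A with h1 | h1
    · refine v1.symm.trans_lt (setInt_lt i1 (k1.add k2) fun h hh => ?_)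
      have := mul_pos (pt_big (h := h) n0 hh h1) (hfpos h hh)
      linarith
    · refine v2.symm.trans_lt (setInt_lt i2 (k1.add k2) fun h hh => ?_)
      have := mul_lt_mul_of_pos_right (pt_small (h := h) n0 hh hA h1) (hfpos h hh)
      linarith
  exact ⟨main, fun τ _ _ h => by linarith⟩
end

section
/- For integers N, M, Nt with 1 ≤ N < M ≤ Nt and reals Ā_N, Ā_M with 0 < Ā_N, Ā_M < ∞: if the power scaling factors coincide, i.e. 0 < Π^(T)(N, Ā_N) = Π^(T)(M, Ā_M) < 1, then the rate scaling factors satisfy Δ^(T)(N, Ā_N) > Δ^(T)(M, Ā_M), where Δ^(T)(N, Ā) = ∫_0^∞ ( 1 − Γ(N, N·Ā/h)/Γ(N) ) f_H(h) dh and Π^(T)(N, Ā) = ∫_0^∞ h · ( Γ(N+1, N·Ā/h)/Γ(N+1) ) f_H(h) dh with f_H(h) = (Nt^{Nt}/Γ(Nt)) h^{Nt−1} e^{−Nt·h}. (Second part of Theorem 3.1: fewer random beams achieve a strictly better asymptotic rate–energy trade-off.) -/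
/-- Rate scaling factor `Δ^(T)(N, Ā)` of threshold switching with `N` Gaussian random beams over
the i.i.d. Rayleigh fading MISO channel with `Nt` transmit antennas. -/
noncomputable def rateScaling (Nt N : ℕ) (A : ℝ) : ℝ :=
  ∫ h in Set.Ioi (0 : ℝ),
    (1 - uiGamma N ((N : ℝ) * A / h) / Real.Gamma N) *
      (((Nt : ℝ) ^ Nt / Real.Gamma Nt) * h ^ (Nt - 1) * Real.exp (-(Nt : ℝ) * h))

/-- Power scaling factor `Π^(T)(N, Ā)` of threshold switching with `N` Gaussian random beams over
the i.i.d. Rayleigh fading MISO channel with `Nt` transmit antennas. -/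
noncomputable def powerScaling (Nt N : ℕ) (A : ℝ) : ℝ :=
  ∫ h in Set.Ioi (0 : ℝ),
    h * (uiGamma ((N : ℝ) + 1) ((N : ℝ) * A / h) / Real.Gamma ((N : ℝ) + 1)) *
      (((Nt : ℝ) ^ Nt / Real.Gamma Nt) * h ^ (Nt - 1) * Real.exp (-(Nt : ℝ) * h))

open Filter Topology MeasureTheory

/-- Regularised upper incomplete Gamma function at an integer. -/
noncomputable def regQ (n : ℕ) (x : ℝ) : ℝ :=
  Real.exp (-x) * ∑ k ∈ Finset.range n, x ^ k / (k.factorial : ℝ)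

lemma regQ_hasDerivAt (m : ℕ) (x : ℝ) :
    HasDerivAt (regQ (m + 1)) (-(Real.exp (-x) * (x ^ m / (m.factorial : ℝ)))) x := by
  have he : HasDerivAt (fun x : ℝ => Real.exp (-x)) (-Real.exp (-x)) x := by
    simpa using (hasDerivAt_neg x).exp
  induction m with
  | zero =>
    have : regQ (0 + 1) = fun x : ℝ => Real.exp (-x) := by
      funext y; simp [regQ]
    rw [this]; simpa using he
  | succ m ih =>
    have : regQ (m + 1 + 1) = fun x : ℝ => regQ (m + 1) x
        + Real.exp (-x) * (x ^ (m + 1) / ((m + 1).factorial : ℝ)) := by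
      funext y
      simp only [regQ]
      rw [Finset.sum_range_succ _ (m + 1)]; ring
    rw [this]
    have h2 := ih.add (he.mul ((hasDerivAt_pow (m + 1) x).div_const ((m + 1).factorial : ℝ)))
    refine h2.congr_deriv ?_
    have hf : (m.factorial : ℝ) ≠ 0 := by positivity
    rw [Nat.factorial_succ]; push_cast
    have hm : (m : ℝ) + 1 ≠ 0 := by positivity
    field_simp
    ring

lemma regQ_nonneg (n : ℕ) {x : ℝ} (hx : 0 ≤ x) : 0 ≤ regQ n x := by
  unfold regQ; positivity

lemma regQ_le_one (n : ℕ) {x : ℝ} (hx : 0 ≤ x) : regQ n x ≤ 1 := by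
  unfold regQ
  calc _ ≤ Real.exp (-x) * Real.exp x := by
        gcongr; exact Real.sum_le_exp_of_nonneg hx n
    _ = 1 := by rw [← Real.exp_add]; simp

lemma regQ_continuous (n : ℕ) : Continuous (regQ n) := by
  unfold regQ; fun_prop

lemma regQ_zero (m : ℕ) : regQ (m + 1) 0 = 1 := by
  simp [regQ, Finset.sum_range_succ']

lemma regQ_tendsto (n : ℕ) : Tendsto (regQ n) atTop (𝓝 0) := by
  have : regQ n = fun x => ∑ k ∈ Finset.range n, (x ^ k * Real.exp (-x)) * (1 / (k.factorial : ℝ)) := by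
    funext x; simp only [regQ, Finset.mul_sum]
    exact Finset.sum_congr rfl fun k _ => by ring
  rw [this]
  have := tendsto_finsetSum (Finset.range n) (fun k _ =>
    (Real.tendsto_pow_mul_exp_neg_atTop_nhds_zero k).mul_const (1 / (k.factorial : ℝ)))
  simpa using this

lemma mul_regQ_tendsto (n : ℕ) : Tendsto (fun x => x * regQ n x) atTop (𝓝 0) := by
  have : (fun x => x * regQ n x) = fun x => ∑ k ∈ Finset.range n,
      (x ^ (k + 1) * Real.exp (-x)) * (1 / (k.factorial : ℝ)) := by
    funext x; simp only [regQ, Finset.mul_sum]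
    exact Finset.sum_congr rfl fun k _ => by ring
  rw [this]
  have := tendsto_finsetSum (Finset.range n) (fun k _ =>
    (Real.tendsto_pow_mul_exp_neg_atTop_nhds_zero (k + 1)).mul_const (1 / (k.factorial : ℝ)))
  simpa using this

lemma uiGamma_eq (m : ℕ) {x : ℝ} (hx : 0 ≤ x) :
    uiGamma ((m : ℝ) + 1) x / Real.Gamma ((m : ℝ) + 1) = regQ (m + 1) x := by
  have hf : (m.factorial : ℝ) ≠ 0 := by positivity
  rw [Real.Gamma_nat_eq_factorial]
  have key : uiGamma ((m : ℝ) + 1) x = 0 - (-(m.factorial : ℝ) * regQ (m + 1) x) := by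
    unfold uiGamma
    refine integral_Ioi_of_hasDerivAt_of_nonneg'
      (g := fun t => -(m.factorial : ℝ) * regQ (m + 1) t) ?_ ?_ ?_
    · intro t ht
      refine ((regQ_hasDerivAt m t).const_mul (-(m.factorial : ℝ))).congr_deriv ?_
      rw [add_sub_cancel_right, Real.rpow_natCast]
      field_simp
    · intro t ht
      have : 0 < t := lt_of_le_of_lt hx ht
      positivity
    · simpa using (regQ_tendsto (m + 1)).const_mul (-(m.factorial : ℝ))
  rw [key]; field_simp; ring

lemma three_phase (F F' F'' : ℝ → ℝ) (h1 : ∀ x, HasDerivAt F (F' x) x)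
    (h2 : ∀ x, HasDerivAt F' (F'' x) x) (h0 : F 0 = 0) (h0' : F' 0 = 0)
    (hl : Tendsto F atTop (𝓝 0)) (hl' : Tendsto F' atTop (𝓝 0))
    (t1 t2 : ℝ) (ht1 : 0 < t1) (ht2 : t1 < t2)
    (p1 : ∀ x, 0 < x → x < t1 → 0 < F'' x) (p2 : ∀ x, t1 < x → x < t2 → F'' x ≤ 0)
    (p3 : ∀ x, t2 < x → 0 < F'' x) : ∀ a, 0 < a → 0 < F a := by
  have cF : Continuous F := continuous_iff_continuousAt.2 fun x => (h1 x).continuousAt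
  have cF' : Continuous F' := continuous_iff_continuousAt.2 fun x => (h2 x).continuousAt
  have A' : StrictMonoOn F' (Set.Icc 0 t1) := by
    refine strictMonoOn_of_deriv_pos (convex_Icc _ _) cF'.continuousOn ?_
    intro x hx; rw [interior_Icc] at hx; rw [(h2 x).deriv]; exact p1 x hx.1 hx.2
  have A : StrictMonoOn F (Set.Icc 0 t1) := by
    refine strictMonoOn_of_deriv_pos (convex_Icc _ _) cF.continuousOn ?_
    intro x hx; rw [interior_Icc] at hx; rw [(h1 x).deriv, ← h0']
    exact A' ⟨le_rfl, ht1.le⟩ ⟨hx.1.le, hx.2.le⟩ hx.1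
  have A0 : ∀ a, 0 < a → a ≤ t1 → 0 < F a := fun a h h' => by
    rw [← h0]; exact A ⟨le_rfl, ht1.le⟩ ⟨h.le, h'⟩ h
  have C' : StrictMonoOn F' (Set.Ici t2) := by
    refine strictMonoOn_of_deriv_pos (convex_Ici _) cF'.continuousOn ?_
    intro x hx; rw [interior_Ici] at hx; rw [(h2 x).deriv]; exact p3 x hx
  have Cn : ∀ x, t2 ≤ x → F' x < 0 := fun x hx => by
    have a1 : F' x < F' (x + 1) := C' hx (Set.mem_Ici.2 (by linarith)) (by linarith)
    have a2 : F' (x + 1) ≤ 0 := ge_of_tendsto hl' (by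
      filter_upwards [eventually_ge_atTop (x + 1)] with y hy
      exact C'.monotoneOn (Set.mem_Ici.2 (by linarith)) (Set.mem_Ici.2 (by linarith)) hy)
    linarith
  have C : StrictAntiOn F (Set.Ici t2) := by
    refine strictAntiOn_of_deriv_neg (convex_Ici _) cF.continuousOn ?_
    intro x hx; rw [interior_Ici] at hx; rw [(h1 x).deriv]; exact Cn x (le_of_lt hx)
  have C0 : ∀ x, t2 ≤ x → 0 < F x := fun x hx => by
    have a1 : F (x + 1) < F x := C hx (Set.mem_Ici.2 (by linarith)) (by linarith)
    have a2 : 0 ≤ F (x + 1) := le_of_tendsto hl (by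
      filter_upwards [eventually_ge_atTop (x + 1)] with y hy
      exact C.antitoneOn (Set.mem_Ici.2 (by linarith)) (Set.mem_Ici.2 (by linarith)) hy)
    linarith
  have B : ConcaveOn ℝ (Set.Icc t1 t2) F := by
    refine concaveOn_of_hasDerivWithinAt2_nonpos (convex_Icc _ _) cF.continuousOn
      (f' := F') (f'' := F'') (fun x _ => (h1 x).hasDerivWithinAt)
      (fun x _ => (h2 x).hasDerivWithinAt) ?_
    intro x hx; rw [interior_Icc] at hx; exact p2 x hx.1 hx.2
  intro a ha
  rcases le_total a t1 with h | h
  · exact A0 a ha h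
  rcases le_total t2 a with h' | h'
  · exact C0 a h'
  have := B.min_le_of_mem_Icc (Set.left_mem_Icc.2 ht2.le) (Set.right_mem_Icc.2 ht2.le) ⟨h, h'⟩
  exact lt_of_lt_of_le (lt_min (A0 _ ht1 le_rfl) (C0 _ le_rfl)) this

/-- density of the normalised Gamma variable with `m+1` degrees. -/
noncomputable def dens (m : ℕ) (a : ℝ) : ℝ :=
  ((m : ℝ) + 1) * (Real.exp (-(((m : ℝ) + 1) * a)) * ((((m : ℝ) + 1) * a) ^ m / (m.factorial : ℝ)))

/-- `a * P(G ≤ b) - E[G; G ≤ b]`. -/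
noncomputable def psi (m : ℕ) (a b : ℝ) : ℝ :=
  a * (1 - regQ (m + 1) (((m : ℝ) + 1) * b)) - (1 - regQ (m + 2) (((m : ℝ) + 1) * b))

lemma cdf_deriv (m : ℕ) (b : ℝ) :
    HasDerivAt (fun b => 1 - regQ (m + 1) (((m : ℝ) + 1) * b)) (dens m b) b := by
  have h := (regQ_hasDerivAt m (((m : ℝ) + 1) * b)).comp b
    ((hasDerivAt_id b).const_mul ((m : ℝ) + 1))
  refine (h.const_sub 1).congr_deriv ?_
  unfold dens; ring

lemma cdf2_deriv (m : ℕ) (b : ℝ) :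
    HasDerivAt (fun b => 1 - regQ (m + 2) (((m : ℝ) + 1) * b)) (b * dens m b) b := by
  have h := (regQ_hasDerivAt (m + 1) (((m : ℝ) + 1) * b)).comp b
    ((hasDerivAt_id b).const_mul ((m : ℝ) + 1))
  refine (h.const_sub 1).congr_deriv ?_
  have hf : (m.factorial : ℝ) ≠ 0 := by positivity
  have hm : (m : ℝ) + 1 ≠ 0 := by positivity
  unfold dens
  rw [Nat.factorial_succ]; push_cast
  field_simp
  ring

lemma psi_le (m : ℕ) {a b : ℝ} (ha : 0 < a) (hb : 0 < b) : psi m a b ≤ psi m a a := by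
  have hd : ∀ x, HasDerivAt (psi m a) ((a - x) * dens m x) x := fun x => by
    refine (((cdf_deriv m x).const_mul a).sub (cdf2_deriv m x)).congr_deriv ?_
    ring
  have hc : Continuous (psi m a) := continuous_iff_continuousAt.2 fun x => (hd x).continuousAt
  have hdn : ∀ x, 0 ≤ x → 0 ≤ dens m x := fun x hx => by unfold dens; positivity
  rcases le_total b a with h | h
  · have : MonotoneOn (psi m a) (Set.Icc 0 a) := by
      refine monotoneOn_of_deriv_nonneg (convex_Icc _ _) hc.continuousOn
        (fun x _ => (hd x).differentiableAt.differentiableWithinAt) ?_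
      intro x hx; rw [interior_Icc] at hx; rw [(hd x).deriv]
      exact mul_nonneg (by linarith [hx.2]) (hdn x hx.1.le)
    exact this ⟨hb.le, h⟩ ⟨ha.le, le_rfl⟩ h
  · have : AntitoneOn (psi m a) (Set.Ici a) := by
      refine antitoneOn_of_deriv_nonpos (convex_Ici _) hc.continuousOn
        (fun x _ => (hd x).differentiableAt.differentiableWithinAt) ?_
      intro x hx; rw [interior_Ici] at hx; rw [(hd x).deriv]
      have hx' : a < x := hx
      exact mul_nonpos_of_nonpos_of_nonneg (by linarith) (hdn x (by linarith))
    exact this (Set.mem_Ici.2 le_rfl) h h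

lemma dens_succ (m : ℕ) (t : ℝ) : dens (m + 1) t =
    dens m t * ((((m : ℝ) + 2) / ((m : ℝ) + 1)) ^ (m + 2) * (t * Real.exp (-t))) := by
  have hf : (m.factorial : ℝ) ≠ 0 := by positivity
  have hm : (m : ℝ) + 1 ≠ 0 := by positivity
  unfold dens
  rw [Nat.factorial_succ]; push_cast
  have : Real.exp (-(((m : ℝ) + 1 + 1) * t)) = Real.exp (-(((m : ℝ) + 1) * t)) * Real.exp (-t) := by
    rw [← Real.exp_add]; ring_nf
  rw [this, div_pow, mul_pow, mul_pow]
  have e : (m : ℝ) + 1 + 1 = m + 2 := by ring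
  rw [e]
  field_simp
  ring

lemma const_gt (m : ℕ) : Real.exp 1 < (((m : ℝ) + 2) / ((m : ℝ) + 1)) ^ (m + 2) := by
  have h2 : (0 : ℝ) < (m : ℝ) + 2 := by positivity
  have h1 : (0 : ℝ) < (m : ℝ) + 1 := by positivity
  have h := Real.add_one_lt_exp (x := -(1 / ((m : ℝ) + 2))) (by
    have : 0 < 1 / ((m : ℝ) + 2) := by positivity
    linarith)
  have e : -(1 / ((m : ℝ) + 2)) + 1 = ((m : ℝ) + 1) / ((m : ℝ) + 2) := by field_simp; ring
  rw [e, Real.exp_neg] at h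
  have h3 : Real.exp (1 / ((m : ℝ) + 2)) < ((m : ℝ) + 2) / ((m : ℝ) + 1) := by
    have := inv_strictAnti₀ (by positivity) h
    rwa [inv_inv, inv_div] at this
  calc Real.exp 1 = Real.exp (1 / ((m : ℝ) + 2)) ^ (m + 2) := by
        rw [← Real.exp_nat_mul]; congr 1; push_cast; field_simp
    _ < _ := pow_lt_pow_left₀ h3 (Real.exp_pos _).le (by omega)

lemma te_deriv (t : ℝ) : HasDerivAt (fun t : ℝ => t * Real.exp (-t)) ((1 - t) * Real.exp (-t)) t := by
  have he : HasDerivAt (fun x : ℝ => Real.exp (-x)) (-Real.exp (-t)) t := by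
    simpa using (hasDerivAt_neg t).exp
  refine ((hasDerivAt_id t).mul he).congr_deriv ?_
  simp; ring

lemma te_mono : StrictMonoOn (fun t : ℝ => t * Real.exp (-t)) (Set.Icc 0 1) := by
  refine strictMonoOn_of_deriv_pos (convex_Icc _ _) (by fun_prop) ?_
  intro x hx; rw [interior_Icc] at hx; rw [(te_deriv x).deriv]
  exact mul_pos (by linarith [hx.2]) (Real.exp_pos _)

lemma te_anti : StrictAntiOn (fun t : ℝ => t * Real.exp (-t)) (Set.Ici 1) := by
  refine strictAntiOn_of_deriv_neg (convex_Ici _) (by fun_prop) ?_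
  intro x hx; rw [interior_Ici] at hx; rw [(te_deriv x).deriv]
  have : (1 : ℝ) < x := hx
  exact mul_neg_of_neg_of_pos (by linarith) (Real.exp_pos _)

lemma psi_hasDerivAt (m : ℕ) (a : ℝ) :
    HasDerivAt (fun a => psi m a a) (1 - regQ (m + 1) (((m : ℝ) + 1) * a)) a := by
  refine (((hasDerivAt_id a).mul (cdf_deriv m a)).sub (cdf2_deriv m a)).congr_deriv ?_
  simp

lemma regQ_lin_tendsto (n m : ℕ) :
    Tendsto (fun a : ℝ => regQ n (((m : ℝ) + 1) * a)) atTop (𝓝 0) :=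
  (regQ_tendsto n).comp (tendsto_id.const_mul_atTop (by positivity))

lemma mul_regQ_lin_tendsto (n m : ℕ) :
    Tendsto (fun a : ℝ => a * regQ n (((m : ℝ) + 1) * a)) atTop (𝓝 0) := by
  have h := ((mul_regQ_tendsto n).comp
    ((tendsto_id (α := ℝ)).const_mul_atTop (r := (m : ℝ) + 1) (by positivity))).const_mul
      (((m : ℝ) + 1)⁻¹)
  rw [mul_zero] at h
  refine h.congr fun a => ?_
  have hm : (m : ℝ) + 1 ≠ 0 := by positivity
  simp only [Function.comp, id]
  field_simp

lemma psi_succ_lt (m : ℕ) {a : ℝ} (ha : 0 < a) : psi (m + 1) a a < psi m a a := by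
  set c := (((m : ℝ) + 2) / ((m : ℝ) + 1)) ^ (m + 2) with hc
  have hce : Real.exp 1 < c := const_gt m
  have hcpos : 0 < c := (Real.exp_pos 1).trans hce
  have q1 : 1 / c < 1 * Real.exp (-1) := by
    rw [one_mul, Real.exp_neg, one_div]; exact inv_strictAnti₀ (Real.exp_pos 1) hce
  have hcont : Continuous (fun t : ℝ => t * Real.exp (-t)) := by fun_prop
  obtain ⟨t1, ht1, e1⟩ : ∃ t ∈ Set.Ioo (0 : ℝ) 1, t * Real.exp (-t) = 1 / c :=
    intermediate_value_Ioo (zero_le_one' ℝ) hcont.continuousOn ⟨by simpa using hcpos, q1⟩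
  have hlim : Tendsto (fun t : ℝ => t * Real.exp (-t)) atTop (𝓝 0) := by
    simpa using Real.tendsto_pow_mul_exp_neg_atTop_nhds_zero 1
  obtain ⟨T, hT1, hT⟩ : ∃ T : ℝ, 1 < T ∧ T * Real.exp (-T) < 1 / c :=
    ((eventually_gt_atTop 1).and (hlim.eventually_lt_const (by positivity : (0 : ℝ) < 1 / c))).exists
  obtain ⟨t2, ht2, e2⟩ : ∃ t ∈ Set.Ioo (1 : ℝ) T, t * Real.exp (-t) = 1 / c :=
    intermediate_value_Ioo' hT1.le hcont.continuousOn ⟨hT, q1⟩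
  have hdp : ∀ x, 0 < x → 0 < dens m x := fun x hx => by unfold dens; positivity
  have hfac : ∀ x, dens m x - dens (m + 1) x = dens m x * (c * (1 / c - x * Real.exp (-x))) := by
    intro x; rw [dens_succ, ← hc]; field_simp
  have key := three_phase (fun a => psi m a a - psi (m + 1) a a)
    (fun a => (1 - regQ (m + 1) (((m : ℝ) + 1) * a)) -
      (1 - regQ (m + 1 + 1) ((((m + 1 : ℕ) : ℝ) + 1) * a)))
    (fun a => dens m a - dens (m + 1) a)
    (fun x => (psi_hasDerivAt m x).sub (psi_hasDerivAt (m + 1) x))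
    (fun x => (cdf_deriv m x).sub (cdf_deriv (m + 1) x))
    (by simp [psi, regQ_zero]) (by simp [regQ_zero])
    (by
      have h := (((regQ_lin_tendsto (m + 2) m).sub (mul_regQ_lin_tendsto (m + 1) m)).sub
        (regQ_lin_tendsto (m + 1 + 2) (m + 1))).add (mul_regQ_lin_tendsto (m + 1 + 1) (m + 1))
      simp only [sub_zero, add_zero] at h
      refine h.congr fun a => ?_
      simp only [psi]; ring)
    (by
      have h := (regQ_lin_tendsto (m + 1 + 1) (m + 1)).sub (regQ_lin_tendsto (m + 1) m)
      simp only [sub_zero] at h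
      refine h.congr fun a => ?_
      ring)
    t1 t2 ht1.1 (ht1.2.trans ht2.1)
    (fun x hx hx1 => by
      rw [hfac]
      have : x * Real.exp (-x) < t1 * Real.exp (-t1) :=
        te_mono ⟨hx.le, (hx1.trans ht1.2).le⟩ ⟨ht1.1.le, ht1.2.le⟩ hx1
      exact mul_pos (hdp x hx) (mul_pos hcpos (by linarith)))
    (fun x hx hx1 => by
      rw [hfac]
      have : 1 / c ≤ x * Real.exp (-x) := by
        rcases le_total x 1 with h | h
        · rw [← e1]
          exact (te_mono ⟨ht1.1.le, ht1.2.le⟩ ⟨ht1.1.le.trans hx.le, h⟩ hx).le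
        · rw [← e2]
          exact (te_anti (Set.mem_Ici.2 h) (Set.mem_Ici.2 ht2.1.le) hx1).le
      refine mul_nonpos_of_nonneg_of_nonpos (hdp x (ht1.1.trans hx)).le
        (mul_nonpos_of_nonneg_of_nonpos hcpos.le (by linarith)))
    (fun x hx => by
      rw [hfac]
      have : x * Real.exp (-x) < t2 * Real.exp (-t2) :=
        te_anti (Set.mem_Ici.2 ht2.1.le) (Set.mem_Ici.2 (ht2.1.trans hx).le) hx
      exact mul_pos (hdp x (by linarith [ht2.1])) (mul_pos hcpos (by linarith)))
    a ha
  simpa using key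

lemma psi_lt {m n : ℕ} (hmn : m < n) {a : ℝ} (ha : 0 < a) : psi n a a < psi m a a :=
  strictAnti_nat_of_succ_lt (f := fun m => psi m a a) (fun m => psi_succ_lt m ha) hmn

/-- The fading density. -/
noncomputable def fH (Nt : ℕ) (h : ℝ) : ℝ :=
  ((Nt : ℝ) ^ Nt / Real.Gamma Nt) * h ^ (Nt - 1) * Real.exp (-(Nt : ℝ) * h)

lemma pow_exp_int (Nt : ℕ) (hNt : 1 ≤ Nt) (k : ℕ) :
    IntegrableOn (fun h : ℝ => h ^ k * Real.exp (-(Nt : ℝ) * h)) (Set.Ioi 0) := by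
  have h := integrableOn_rpow_mul_exp_neg_mul_rpow (p := 1) (s := (k : ℝ)) (b := (Nt : ℝ))
    (by have : (0 : ℝ) ≤ k := by positivity
        linarith) one_pos (by exact_mod_cast hNt)
  simpa using h

lemma fH_int (Nt : ℕ) (hNt : 1 ≤ Nt) : IntegrableOn (fH Nt) (Set.Ioi 0) := by
  have := (pow_exp_int Nt hNt (Nt - 1)).const_mul ((Nt : ℝ) ^ Nt / Real.Gamma Nt)
  refine this.congr (Eventually.of_forall fun h => ?_)
  simp only [fH]; ring

lemma hfH_int (Nt : ℕ) (hNt : 1 ≤ Nt) : IntegrableOn (fun h => h * fH Nt h) (Set.Ioi 0) := by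
  have := (pow_exp_int Nt hNt (Nt - 1 + 1)).const_mul ((Nt : ℝ) ^ Nt / Real.Gamma Nt)
  refine this.congr (Eventually.of_forall fun h => ?_)
  simp only [fH]; ring

lemma bdd_int (n : ℕ) (c : ℝ) (hc : 0 < c) (f : ℝ → ℝ) (hf : IntegrableOn f (Set.Ioi 0)) :
    IntegrableOn (fun h => regQ n (c / h) * f h) (Set.Ioi 0) := by
  refine Integrable.bdd_mul (c := 1) hf ?_ ?_
  · exact ((regQ_continuous n).measurable.comp (measurable_const.div measurable_id)).aestronglyMeasurable
  · refine (ae_restrict_iff' measurableSet_Ioi).2 (Eventually.of_forall fun h hh => ?_)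
    have : 0 ≤ c / h := (div_pos hc hh).le
    rw [Real.norm_of_nonneg (regQ_nonneg n this)]
    exact regQ_le_one n this

lemma rate_eq (Nt m : ℕ) (A : ℝ) (hA : 0 < A) : rateScaling Nt (m + 1) A =
    ∫ h in Set.Ioi (0 : ℝ), (1 - regQ (m + 1) (((m : ℝ) + 1) * A / h)) * fH Nt h := by
  unfold rateScaling
  refine setIntegral_congr_fun measurableSet_Ioi fun h hh => ?_
  have hh' : (0 : ℝ) < h := hh
  simp only [fH]; push_cast
  rw [uiGamma_eq m (by positivity)]

lemma power_eq (Nt m : ℕ) (A : ℝ) (hA : 0 < A) : powerScaling Nt (m + 1) A =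
    ∫ h in Set.Ioi (0 : ℝ), regQ (m + 2) (((m : ℝ) + 1) * A / h) * (h * fH Nt h) := by
  unfold powerScaling
  refine setIntegral_congr_fun measurableSet_Ioi fun h hh => ?_
  have hh' : (0 : ℝ) < h := hh
  have := uiGamma_eq (m + 1) (x := ((m : ℝ) + 1) * A / h) (by positivity)
  push_cast at this
  simp only [fH]; push_cast
  rw [this]; ring

lemma rate_int (Nt m : ℕ) (hNt : 1 ≤ Nt) (A : ℝ) (hA : 0 < A) :
    IntegrableOn (fun h => (1 - regQ (m + 1) (((m : ℝ) + 1) * A / h)) * fH Nt h) (Set.Ioi 0) := by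
  have := (fH_int Nt hNt).sub (bdd_int (m + 1) (((m : ℝ) + 1) * A) (by positivity) _ (fH_int Nt hNt))
  refine this.congr (Eventually.of_forall fun h => ?_)
  simp only [Pi.sub_apply]; ring

lemma comb_eq (Nt m : ℕ) (hNt : 1 ≤ Nt) (A B : ℝ) (hA : 0 < A) :
    IntegrableOn (fun h => B * ((1 - regQ (m + 1) (((m : ℝ) + 1) * A / h)) * fH Nt h)
      + regQ (m + 2) (((m : ℝ) + 1) * A / h) * (h * fH Nt h)) (Set.Ioi 0) ∧
    ∫ h in Set.Ioi (0 : ℝ), (B * ((1 - regQ (m + 1) (((m : ℝ) + 1) * A / h)) * fH Nt h)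
      + regQ (m + 2) (((m : ℝ) + 1) * A / h) * (h * fH Nt h))
      = B * rateScaling Nt (m + 1) A + powerScaling Nt (m + 1) A := by
  have i1 := (rate_int Nt m hNt A hA).const_mul B
  have i2 := bdd_int (m + 2) (((m : ℝ) + 1) * A) (by positivity) _ (hfH_int Nt hNt)
  refine ⟨i1.add i2, ?_⟩
  rw [integral_add i1 i2, integral_const_mul, rate_eq Nt m A hA, power_eq Nt m A hA]

/-- Second part of Theorem 3.1: fewer random beams achieve a strictly better asymptotic
rate–energy trade-off. -/
theorem fewer_beams_better_tradeoff (N M Nt : ℕ) (hN : 1 ≤ N) (hNM : N < M) (hMNt : M ≤ Nt)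
    (AN AM : ℝ) (hAN : 0 < AN) (hAM : 0 < AM)
    (heq : powerScaling Nt N AN = powerScaling Nt M AM)
    (hpos : 0 < powerScaling Nt N AN) (hlt : powerScaling Nt N AN < 1) :
    rateScaling Nt M AM < rateScaling Nt N AN := by
  obtain ⟨m, rfl⟩ : ∃ m, N = m + 1 := ⟨N - 1, by omega⟩
  obtain ⟨n, rfl⟩ : ∃ n, M = n + 1 := ⟨M - 1, by omega⟩
  have hNt : 1 ≤ Nt := by omega
  obtain ⟨iN, eN⟩ := comb_eq Nt m hNt AN AN hAN
  obtain ⟨iM, eM⟩ := comb_eq Nt n hNt AM AN hAM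
  have hpt : ∀ h ∈ Set.Ioi (0 : ℝ),
      AN * ((1 - regQ (n + 1) (((n : ℝ) + 1) * AM / h)) * fH Nt h)
        + regQ (n + 2) (((n : ℝ) + 1) * AM / h) * (h * fH Nt h)
      < AN * ((1 - regQ (m + 1) (((m : ℝ) + 1) * AN / h)) * fH Nt h)
        + regQ (m + 2) (((m : ℝ) + 1) * AN / h) * (h * fH Nt h) := by
    intro h hh
    have hh' : (0 : ℝ) < h := hh
    have hf : 0 < fH Nt h := by
      have : (0 : ℝ) < Nt := by exact_mod_cast hNt
      have := Real.Gamma_pos_of_pos this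
      unfold fH; positivity
    have ha : 0 < AN / h := by positivity
    have hb : 0 < AM / h := by positivity
    have h1 := (psi_le n ha hb).trans_lt (psi_lt (by omega : m < n) ha)
    have h2 := mul_lt_mul_of_pos_right h1 (mul_pos hh' hf)
    simp only [psi, ← mul_div_assoc] at h2
    have e : ∀ u v : ℝ, (AN / h * (1 - u) - (1 - v)) * (h * fH Nt h)
        = AN * ((1 - u) * fH Nt h) + v * (h * fH Nt h) - h * fH Nt h := by
      intro u v; field_simp; ring
    have e' : ∀ u v : ℝ, (AN * (1 - u) / h - (1 - v)) * (h * fH Nt h)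
        = AN * ((1 - u) * fH Nt h) + v * (h * fH Nt h) - h * fH Nt h := by
      intro u v; field_simp; ring
    first
      | (rw [e, e] at h2; linarith)
      | (rw [e', e'] at h2; linarith)
  have hlt2 : AN * rateScaling Nt (n + 1) AM + powerScaling Nt (n + 1) AM
      < AN * rateScaling Nt (m + 1) AN + powerScaling Nt (m + 1) AN := by
    rw [← eN, ← eM, ← sub_pos, ← integral_sub iN iM]
    refine (setIntegral_pos_iff_support_of_nonneg_ae ?_ (iN.sub iM)).2 ?_
    rotate_left
    · refine lt_of_lt_of_le (b := volume (Set.Ioi (0 : ℝ))) (by simp) (measure_mono ?_)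
      intro h hh
      exact ⟨(sub_pos.2 (hpt h hh)).ne', hh⟩
    · refine (ae_restrict_iff' measurableSet_Ioi).2 (Eventually.of_forall fun h hh => ?_)
      exact (sub_pos.2 (hpt h hh)).le
  rw [heq] at hlt2
  exact lt_of_mul_lt_mul_left (by linarith) hAN.le
end

section
/- Let A be a nonnegative real random variable whose law is absolutely continuous with respect to Lebesgue measure (i.e. A has a density g on [0, ∞)), with finite mean b = E[A], and suppose its CDF G satisfies G(a) > 0 for all a > 0. If Ā ∈ (0, ∞) is such that G(Ā) = τ with 0 < τ < 1, then ∫_{Ā}^∞ a·g(a) da > (1 − τ)·b, i.e. E[A·1{A > Ā}] > (1 − τ)·E[A]. (Lemma E.1 of the paper: threshold switching harvests strictly more power than periodic switching for the same fraction of time allocated to information decoding.) -/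
/-- Lemma E.1: if `A` has density `g` on `[0, ∞)` with finite mean `b`, CDF `G` positive on
`(0, ∞)`, and `G(Ā) = τ` with `0 < τ < 1`, then `∫_Ā^∞ a·g(a) da > (1 − τ)·b`: threshold
switching harvests strictly more power than periodic switching for the same fraction of time
allocated to information decoding. -/
theorem tail_moment_exceeds_proportional_mean
    (g : ℝ → ℝ) (hg_meas : Measurable g) (hg_nonneg : ∀ a : ℝ, 0 ≤ g a)
    (hg_int : MeasureTheory.IntegrableOn g (Set.Ioi 0))
    (hg_prob : ∫ a in Set.Ioi (0 : ℝ), g a = 1)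
    (hmean_int : MeasureTheory.IntegrableOn (fun a => a * g a) (Set.Ioi 0))
    (b : ℝ) (hb : b = ∫ a in Set.Ioi (0 : ℝ), a * g a)
    (G : ℝ → ℝ) (hG : ∀ a : ℝ, G a = ∫ t in Set.Ioc (0 : ℝ) a, g t)
    (hGpos : ∀ a : ℝ, 0 < a → 0 < G a)
    (A τ : ℝ) (hA : 0 < A) (hτ0 : 0 < τ) (hτ1 : τ < 1) (hGA : G A = τ) :
    (1 - τ) * b < ∫ a in Set.Ioi A, a * g a := by
  have split : ∀ (f : ℝ → ℝ), MeasureTheory.IntegrableOn f (Set.Ioi 0) →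
      (∫ a in Set.Ioi (0 : ℝ), f a) = (∫ a in Set.Ioc 0 A, f a) + ∫ a in Set.Ioi A, f a := by
    intro f hf
    rw [← Set.Ioc_union_Ioi_eq_Ioi hA.le]
    exact MeasureTheory.setIntegral_union (Set.Ioc_disjoint_Ioi le_rfl) measurableSet_Ioi
      (hf.mono_set Set.Ioc_subset_Ioi_self) (hf.mono_set (Set.Ioi_subset_Ioi hA.le))
  have split2 : ∀ (f : ℝ → ℝ), MeasureTheory.IntegrableOn f (Set.Ioi 0) →
      (∫ a in Set.Ioc (0 : ℝ) A, f a)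
        = (∫ a in Set.Ioc 0 (A/2), f a) + ∫ a in Set.Ioc (A/2) A, f a := by
    intro f hf
    have h1 : (0:ℝ) ≤ A/2 := by linarith
    have h2 : A/2 ≤ A := by linarith
    rw [← Set.Ioc_union_Ioc_eq_Ioc h1 h2]
    exact MeasureTheory.setIntegral_union (Set.Ioc_disjoint_Ioc_of_le le_rfl) measurableSet_Ioc
      (hf.mono_set Set.Ioc_subset_Ioi_self)
      (hf.mono_set (Set.Ioc_subset_Ioi_self.trans (Set.Ioi_subset_Ioi h1)))
  have upper : ∀ x y : ℝ, 0 ≤ x →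
      (∫ a in Set.Ioc x y, a * g a) ≤ y * ∫ a in Set.Ioc x y, g a := by
    intro x y hx
    have hs : Set.Ioc x y ⊆ Set.Ioi 0 := Set.Ioc_subset_Ioi_self.trans (Set.Ioi_subset_Ioi hx)
    rw [← MeasureTheory.integral_const_mul]
    exact MeasureTheory.setIntegral_mono_on (hmean_int.mono_set hs)
      ((hg_int.mono_set hs).const_mul y) measurableSet_Ioc
      (fun a ha => mul_le_mul_of_nonneg_right ha.2 (hg_nonneg a))
  have lower : A * (∫ a in Set.Ioi A, g a) ≤ ∫ a in Set.Ioi A, a * g a := by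
    have hs : Set.Ioi A ⊆ Set.Ioi 0 := Set.Ioi_subset_Ioi hA.le
    rw [← MeasureTheory.integral_const_mul]
    exact MeasureTheory.setIntegral_mono_on ((hg_int.mono_set hs).const_mul A)
      (hmean_int.mono_set hs) measurableSet_Ioi
      (fun a ha => mul_le_mul_of_nonneg_right (le_of_lt ha) (hg_nonneg a))
  have e1 := split g hg_int
  have e2 := split _ hmean_int
  have e3 := split2 g hg_int
  have e4 := split2 _ hmean_int
  have u1 := upper 0 (A/2) le_rfl
  have u2 := upper (A/2) A (by linarith)
  have p := hGpos (A/2) (by linarith)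
  rw [← hG, hGA] at e1 e3
  rw [← hG] at e3 u1
  rw [hg_prob] at e1
  rw [← hb] at e2
  have p2 := mul_pos hA p
  have q : (∫ a in Set.Ioi A, g a) = 1 - τ := by linarith
  have r : (∫ a in Set.Ioc (A/2) A, g a) = τ - G (A/2) := by linarith
  rw [q] at lower
  rw [r] at u2
  have hL : (∫ a in Set.Ioc (0:ℝ) A, a * g a) < A * τ := by rw [e4]; linarith
  rw [e2]
  have m1 := mul_lt_mul_of_pos_left hL (sub_pos.2 hτ1)
  have m2 := mul_le_mul_of_nonneg_left lower hτ0.le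
  linarith
end

section
/- Let A_g and A_u be nonnegative real random variables with densities g and u on [0, ∞) respectively, having the same finite mean b = ∫_0^∞ a·g(a) da = ∫_0^∞ a·u(a) da > 0, whose CDFs G and U satisfy G(a) > 0 and U(a) > 0 for all a > 0, and which cross exactly once: there exists Â > 0 with G(a) > U(a) for 0 < a < Â, G(Â) = U(Â), and G(a) < U(a) for a > Â. If Ā_g, Ā_u ∈ (0, ∞) satisfy G(Ā_g) = U(Ā_u) and 0 < G(Ā_g) < 1, then ∫_{Ā_g}^∞ a·g(a) da > ∫_{Ā_u}^∞ a·u(a) da. (Lemma F.1 of the paper: among equal-mean channel-power distributions with a single CDF crossing, the more spread-out one yields a strictly larger tail first moment at the matched quantile.) -/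
open MeasureTheory Set Filter Topology

theorem sl_integrable (f : ℝ → ℝ) (hm : Measurable f) (hn : ∀ a, 0 ≤ f a)
    (hi : IntegrableOn f (Ioi 0)) (hmi : IntegrableOn (fun a => a * f a) (Ioi 0)) (c : ℝ) :
    IntegrableOn (fun a => max (a - c) 0 * f a) (Ioi 0) := by
  have h : IntegrableOn (fun a => a * f a + |c| * f a) (Ioi 0) := hmi.add (hi.const_mul _)
  refine Integrable.mono' h (by fun_prop) ?_
  refine (ae_restrict_iff' measurableSet_Ioi).2 (ae_of_all _ fun a ha => ?_)
  have ha' : 0 < a := ha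
  rw [Real.norm_of_nonneg (mul_nonneg (le_max_right _ _) (hn a)), ← add_mul]
  refine mul_le_mul_of_nonneg_right (max_le ?_ ?_) (hn a)
  · linarith [neg_abs_le c]
  · positivity

theorem sl_tail (f : ℝ → ℝ) (hi : IntegrableOn f (Ioi 0)) (hp : ∫ a in Ioi (0 : ℝ), f a = 1)
    (c : ℝ) (hc : 0 ≤ c) :
    ∫ a in Ioi c, f a = 1 - ∫ a in Ioc 0 c, f a := by
  have h := setIntegral_union (μ := volume) (f := f) (Ioc_disjoint_Ioi (le_refl c) (a := 0))
    measurableSet_Ioi (hi.mono_set Ioc_subset_Ioi_self) (hi.mono_set (Ioi_subset_Ioi hc))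
  rw [Ioc_union_Ioi_eq_Ioi hc, hp] at h
  linarith

theorem sl_deriv (f : ℝ → ℝ) (hm : Measurable f) (hn : ∀ a, 0 ≤ f a)
    (hi : IntegrableOn f (Ioi 0)) (hmi : IntegrableOn (fun a => a * f a) (Ioi 0))
    (hp : ∫ a in Ioi (0 : ℝ), f a = 1) (c : ℝ) (hc : 0 ≤ c) :
    HasDerivAt (fun x => ∫ a in Ioi (0 : ℝ), max (a - x) 0 * f a)
      ((∫ a in Ioc 0 c, f a) - 1) c := by
  have key := hasDerivAt_integral_of_dominated_loc_of_lip (μ := volume.restrict (Ioi (0 : ℝ)))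
    (F := fun x a => max (a - x) 0 * f a) (F' := (Ioi c).indicator (fun a => - f a))
    (x₀ := c) (bound := f) (s := univ) univ_mem
    (Eventually.of_forall fun x => by fun_prop)
    (sl_integrable f hm hn hi hmi c)
    ((hm.neg.indicator measurableSet_Ioi).aestronglyMeasurable) ?_ hi ?_
  · have h2 := key.2
    rw [setIntegral_indicator measurableSet_Ioi, Ioi_inter_Ioi, sup_of_le_right hc, integral_neg,
      sl_tail f hi hp c hc] at h2
    exact h2.congr_deriv (by ring)
  · refine ae_of_all _ fun a => ?_
    rw [LipschitzOnWith]
    intro x _ y _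
    rw [edist_dist, edist_dist, Real.dist_eq, Real.dist_eq, ← sub_mul, abs_mul,
      ← ENNReal.ofReal_coe_nnreal, ← ENNReal.ofReal_mul (by positivity)]
    refine ENNReal.ofReal_le_ofReal ?_
    rw [Real.coe_nnabs, mul_comm]
    refine mul_le_mul_of_nonneg_left ?_ (abs_nonneg _)
    refine (abs_max_sub_max_le_abs _ _ _).trans ?_
    rw [abs_sub_comm x y]
    apply le_of_eq; congr 1; ring
  · have hne : ∀ᵐ a ∂(volume.restrict (Ioi (0 : ℝ))), a ≠ c :=
      ae_restrict_of_ae (by simp [ae_iff])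
    filter_upwards [hne] with a ha
    rcases lt_or_gt_of_ne ha with h | h
    · rw [indicator_of_notMem (by simpa using h.le)]
      refine (hasDerivAt_const c (0 : ℝ)).congr_of_eventuallyEq ?_
      filter_upwards [lt_mem_nhds h] with x hx
      rw [max_eq_right (by linarith), zero_mul]
    · rw [indicator_of_mem (by simpa using h)]
      have h3 : HasDerivAt (fun x => (a - x) * f a) (- f a) c := by
        simpa using ((hasDerivAt_id c).const_sub a).mul_const (f a)
      refine h3.congr_of_eventuallyEq ?_
      filter_upwards [gt_mem_nhds h] with x hx
      rw [max_eq_left (by linarith)]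

theorem sl_lim (f : ℝ → ℝ) (hm : Measurable f) (hn : ∀ a, 0 ≤ f a)
    (hmi : IntegrableOn (fun a => a * f a) (Ioi 0)) :
    Tendsto (fun x => ∫ a in Ioi (0 : ℝ), max (a - x) 0 * f a) atTop (𝓝 0) := by
  have := tendsto_integral_filter_of_dominated_convergence (μ := volume.restrict (Ioi (0 : ℝ)))
    (F := fun x a => max (a - x) 0 * f a) (f := fun _ => (0 : ℝ)) (l := atTop)
    (fun a => a * f a) (Eventually.of_forall fun x => by fun_prop) ?_ hmi ?_
  · simpa using this
  · filter_upwards [eventually_ge_atTop 0] with x hx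
    refine (ae_restrict_iff' measurableSet_Ioi).2 (ae_of_all _ fun a ha => ?_)
    have ha' : 0 < a := ha
    rw [Real.norm_of_nonneg (mul_nonneg (le_max_right _ _) (hn a))]
    exact mul_le_mul_of_nonneg_right (max_le (by linarith) ha'.le) (hn a)
  · refine ae_of_all _ fun a => tendsto_const_nhds.congr' ?_
    filter_upwards [eventually_ge_atTop a] with x hx
    rw [max_eq_right (by linarith), zero_mul]

theorem sl_shift (f : ℝ → ℝ) (hi : IntegrableOn f (Ioi 0))
    (hmi : IntegrableOn (fun a => a * f a) (Ioi 0))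
    (hp : ∫ a in Ioi (0 : ℝ), f a = 1) (A c : ℝ) (hA : 0 ≤ A) :
    ∫ a in Ioi A, (a - c) * f a = (∫ a in Ioi A, a * f a) - c * (1 - ∫ a in Ioc 0 A, f a) := by
  rw [← sl_tail f hi hp A hA, ← integral_const_mul, ← integral_sub]
  · simp_rw [sub_mul]
  · exact hmi.mono_set (Ioi_subset_Ioi hA)
  · exact (hi.mono_set (Ioi_subset_Ioi hA)).const_mul c

theorem sl_le (f : ℝ → ℝ) (hm : Measurable f) (hn : ∀ a, 0 ≤ f a)
    (hi : IntegrableOn f (Ioi 0)) (hmi : IntegrableOn (fun a => a * f a) (Ioi 0))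
    (A c : ℝ) (hA : 0 ≤ A) :
    ∫ a in Ioi A, (a - c) * f a ≤ ∫ a in Ioi (0 : ℝ), max (a - c) 0 * f a := by
  have hI := sl_integrable f hm hn hi hmi c
  refine le_trans (integral_mono (g := fun a => max (a - c) 0 * f a) ?_
    (hI.mono_set (Ioi_subset_Ioi hA)) ?_)
    (setIntegral_mono_set hI ?_ (Ioi_subset_Ioi hA).eventuallyLE)
  · simp_rw [sub_mul]
    exact (hmi.mono_set (Ioi_subset_Ioi hA)).sub ((hi.mono_set (Ioi_subset_Ioi hA)).const_mul c)
  · exact fun a => mul_le_mul_of_nonneg_right (le_max_left _ _) (hn a)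
  · exact ae_of_all _ fun a => mul_nonneg (le_max_right _ _) (hn a)

theorem sl_eq (f : ℝ → ℝ) (c : ℝ) (hc : 0 ≤ c) :
    ∫ a in Ioi (0 : ℝ), max (a - c) 0 * f a = ∫ a in Ioi c, (a - c) * f a := by
  have : (∫ a in Ioi c, (a - c) * f a) = ∫ a in Ioi c, max (a - c) 0 * f a := by
    refine setIntegral_congr_fun measurableSet_Ioi fun a ha => ?_
    have : c < a := ha
    simp only [max_eq_left (sub_nonneg.2 this.le)]
  rw [this]
  refine (setIntegral_eq_of_subset_of_forall_sdiff_eq_zero measurableSet_Ioi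
    (Ioi_subset_Ioi hc) fun a ha => ?_)
  have : a ≤ c := by simpa using ha.2
  rw [max_eq_right (by linarith), zero_mul]

/-- Lemma F.1: among two equal-mean densities `g`, `u` on `[0, ∞)` whose CDFs `G`, `U` cross
exactly once at `Â` (with `G > U` before and `G < U` after), the tail first moment of `g` at its
matched quantile strictly exceeds that of `u`. -/
theorem single_crossing_tail_moment_comparison
    (g u : ℝ → ℝ) (hg_meas : Measurable g) (hu_meas : Measurable u)
    (hg_nonneg : ∀ a : ℝ, 0 ≤ g a) (hu_nonneg : ∀ a : ℝ, 0 ≤ u a)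
    (hg_int : MeasureTheory.IntegrableOn g (Set.Ioi 0))
    (hu_int : MeasureTheory.IntegrableOn u (Set.Ioi 0))
    (hg_prob : ∫ a in Set.Ioi (0 : ℝ), g a = 1)
    (hu_prob : ∫ a in Set.Ioi (0 : ℝ), u a = 1)
    (hgmean_int : MeasureTheory.IntegrableOn (fun a => a * g a) (Set.Ioi 0))
    (humean_int : MeasureTheory.IntegrableOn (fun a => a * u a) (Set.Ioi 0))
    (b : ℝ) (hb_pos : 0 < b)
    (hbg : b = ∫ a in Set.Ioi (0 : ℝ), a * g a)
    (hbu : b = ∫ a in Set.Ioi (0 : ℝ), a * u a)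
    (G U : ℝ → ℝ)
    (hG : ∀ a : ℝ, G a = ∫ t in Set.Ioc (0 : ℝ) a, g t)
    (hU : ∀ a : ℝ, U a = ∫ t in Set.Ioc (0 : ℝ) a, u t)
    (hGpos : ∀ a : ℝ, 0 < a → 0 < G a) (hUpos : ∀ a : ℝ, 0 < a → 0 < U a)
    (Ahat : ℝ) (hAhat : 0 < Ahat)
    (hbefore : ∀ a : ℝ, 0 < a → a < Ahat → U a < G a)
    (hat : G Ahat = U Ahat)
    (hafter : ∀ a : ℝ, Ahat < a → G a < U a)
    (Ag Au : ℝ) (hAg : 0 < Ag) (hAu : 0 < Au)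
    (hmatch : G Ag = U Au) (hq0 : 0 < G Ag) (hq1 : G Ag < 1) :
    ∫ a in Set.Ioi Au, a * u a < ∫ a in Set.Ioi Ag, a * g a := by
  have hQd : ∀ c : ℝ, 0 ≤ c → HasDerivAt (fun x => (∫ a in Ioi (0 : ℝ), max (a - x) 0 * g a)
      - ∫ a in Ioi (0 : ℝ), max (a - x) 0 * u a) (G c - U c) c := by
    intro c hc
    refine HasDerivAt.congr_deriv ((sl_deriv g hg_meas hg_nonneg hg_int hgmean_int hg_prob c hc).sub
      (sl_deriv u hu_meas hu_nonneg hu_int humean_int hu_prob c hc)) ?_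
    rw [hG, hU]; ring
  have hQl : Tendsto (fun x => (∫ a in Ioi (0 : ℝ), max (a - x) 0 * g a)
      - ∫ a in Ioi (0 : ℝ), max (a - x) 0 * u a) atTop (𝓝 0) := by
    simpa using (sl_lim g hg_meas hg_nonneg hgmean_int).sub
      (sl_lim u hu_meas hu_nonneg humean_int)
  have hQ0 : (∫ a in Ioi (0 : ℝ), max (a - 0) 0 * g a)
      - ∫ a in Ioi (0 : ℝ), max (a - 0) 0 * u a = 0 := by
    rw [sl_eq g 0 le_rfl, sl_eq u 0 le_rfl]
    simp only [sub_zero]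
    rw [← hbg, ← hbu, sub_self]
  have hQpos : 0 < (∫ a in Ioi (0 : ℝ), max (a - Ag) 0 * g a)
      - ∫ a in Ioi (0 : ℝ), max (a - Ag) 0 * u a := by
    generalize hQ : (fun x => (∫ a in Ioi (0 : ℝ), max (a - x) 0 * g a)
      - ∫ a in Ioi (0 : ℝ), max (a - x) 0 * u a) = Q at hQd hQl
    have e0 : Q 0 = 0 := by rw [← hQ]; exact hQ0
    have eA : (∫ a in Ioi (0 : ℝ), max (a - Ag) 0 * g a)
      - ∫ a in Ioi (0 : ℝ), max (a - Ag) 0 * u a = Q Ag := by rw [← hQ]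
    rw [eA]
    rcases le_total Ag Ahat with h | h
    · have hm : StrictMonoOn Q (Icc 0 Ahat) := by
        refine strictMonoOn_of_deriv_pos (convex_Icc _ _)
          (fun x hx => (hQd x hx.1).continuousAt.continuousWithinAt) fun x hx => ?_
        rw [interior_Icc] at hx
        rw [(hQd x hx.1.le).deriv]
        exact sub_pos.2 (hbefore x hx.1 hx.2)
      rw [← e0]
      exact hm ⟨le_rfl, hAhat.le⟩ ⟨hAg.le, h⟩ hAg
    · have hm : StrictAntiOn Q (Ici Ahat) := by
        refine strictAntiOn_of_deriv_neg (convex_Ici _)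
          (fun x hx => (hQd x (hAhat.le.trans hx)).continuousAt.continuousWithinAt) fun x hx => ?_
        rw [interior_Ici] at hx
        have hx' : Ahat < x := hx
        rw [(hQd x (hAhat.trans hx').le).deriv]
        exact sub_neg.2 (hafter x hx')
      have h1 : Q (Ag + 1) < Q Ag := hm h (by simp only [mem_Ici]; linarith) (by linarith)
      refine lt_of_le_of_lt (le_of_tendsto hQl ?_) h1
      filter_upwards [eventually_ge_atTop (Ag + 1)] with x hx
      exact hm.antitoneOn (by simp only [mem_Ici]; linarith)
        (by simp only [mem_Ici]; linarith) hx
  have h1 := sl_le u hu_meas hu_nonneg hu_int humean_int Au Ag hAu.le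
  rw [sl_shift u hu_int humean_int hu_prob Au Ag hAu.le, ← hU, ← hmatch] at h1
  have h2 := sl_eq g Ag hAg.le
  rw [sl_shift g hg_int hgmean_int hg_prob Ag Ag hAg.le, ← hG] at h2
  linarith
end

section
/- Let Nt ≥ 1 be an integer and define F_H(x) = 1 − Γ(Nt, Nt·x)/Γ(Nt) for x ≥ 0 (the CDF of the normalized channel power of an Nt-antenna i.i.d. Rayleigh fading MISO channel). For any fixed constants Q̂ > 0 and θ > 0, lim_{P→∞} ( −ln( F_H( Q̂/(θ·P) ) ) / ln(P) ) = Nt. (Proposition 3.3, case Ā = 0: the power diversity order of the pure wireless-energy-transfer scheme equals Nt.) -/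
/-- Lower incomplete Gamma as complement of the upper one. -/
theorem aux_split (N : ℕ) (hN : 1 ≤ N) (y : ℝ) (hy : 0 < y) :
    Real.Gamma N - uiGamma N y = ∫ t in (0:ℝ)..y, t ^ (N - 1) * Real.exp (-t) := by
  have hN0 : (0:ℝ) < N := by exact_mod_cast hN
  have hint := Real.GammaIntegral_convergent hN0
  have hcomm : (fun t : ℝ => Real.exp (-t) * t ^ ((N:ℝ) - 1)) =
      fun t : ℝ => t ^ ((N:ℝ) - 1) * Real.exp (-t) := by
    funext t; ring
  rw [hcomm] at hint
  have h1 : Real.Gamma N = ∫ t in Set.Ioi (0:ℝ), t ^ ((N:ℝ) - 1) * Real.exp (-t) := by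
    rw [Real.Gamma_eq_integral hN0, hcomm]
  have hU : Set.Ioi (0:ℝ) = Set.Ioc 0 y ∪ Set.Ioi y := (Set.Ioc_union_Ioi_eq_Ioi hy.le).symm
  have h2 := MeasureTheory.setIntegral_union (μ := MeasureTheory.volume)
    (f := fun t : ℝ => t ^ ((N:ℝ) - 1) * Real.exp (-t)) (Set.Ioc_disjoint_Ioi (le_refl y) (a := 0))
    measurableSet_Ioi (hint.mono_set Set.Ioc_subset_Ioi_self)
    (hint.mono_set (Set.Ioi_subset_Ioi hy.le))
  rw [← hU] at h2
  rw [h1, h2, uiGamma, add_sub_cancel_right, intervalIntegral.integral_of_le hy.le]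
  refine MeasureTheory.setIntegral_congr_fun measurableSet_Ioc ?_
  intro t ht
  have : ((N:ℝ) - 1) = ((N - 1 : ℕ) : ℝ) := by push_cast [hN]; ring
  simp only [this, Real.rpow_natCast]

theorem aux_bounds (N : ℕ) (hN : 1 ≤ N) (y : ℝ) (hy : 0 < y) :
    Real.exp (-y) * (y ^ N / N) ≤ Real.Gamma N - uiGamma N y ∧
      Real.Gamma N - uiGamma N y ≤ y ^ N / N := by
  rw [aux_split N hN y hy]
  have hp : ∫ t in (0:ℝ)..y, t ^ (N - 1) = y ^ N / N := by
    rw [integral_pow]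
    have : N - 1 + 1 = N := by omega
    have h2 : ((N - 1 : ℕ) : ℝ) + 1 = N := by exact_mod_cast this
    rw [this, h2, zero_pow (by omega), sub_zero]
  rw [← hp]
  constructor
  · rw [← intervalIntegral.integral_const_mul]
    refine intervalIntegral.integral_mono_on hy.le
      (Continuous.intervalIntegrable (by fun_prop) _ _)
      (Continuous.intervalIntegrable (by fun_prop) _ _) ?_
    intro t ht
    rw [mul_comm]
    exact mul_le_mul_of_nonneg_left (Real.exp_le_exp.2 (by linarith [ht.2])) (pow_nonneg ht.1 _)
  · refine intervalIntegral.integral_mono_on hy.le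
      (Continuous.intervalIntegrable (by fun_prop) _ _)
      (Continuous.intervalIntegrable (by fun_prop) _ _) ?_
    intro t ht
    exact mul_le_of_le_one_right (pow_nonneg ht.1 _) (Real.exp_le_one_iff.2 (by linarith [ht.1]))

/-- Proposition 3.3 (case `Ā = 0`): the power diversity order of the pure wireless-energy-transfer
scheme equals `Nt`: `−ln(F_H(Q̂/(θP)))/ln(P) → Nt` as `P → ∞`. -/
theorem power_diversity_order_pure_WET (Nt : ℕ) (hNt : 1 ≤ Nt)
    (Qhat θ : ℝ) (hQhat : 0 < Qhat) (hθ : 0 < θ)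
    (FH : ℝ → ℝ)
    (hFH : ∀ x : ℝ, FH x = 1 - uiGamma Nt ((Nt : ℝ) * x) / Real.Gamma Nt) :
    Filter.Tendsto (fun P : ℝ => -Real.log (FH (Qhat / (θ * P))) / Real.log P)
      Filter.atTop (nhds (Nt : ℝ)) := by
  have hN0 : (0:ℝ) < Nt := by exact_mod_cast hNt
  have hG : 0 < Real.Gamma Nt := Real.Gamma_pos_of_pos hN0
  obtain ⟨c, hc⟩ : ∃ c : ℝ, c = Nt * Qhat / θ := ⟨_, rfl⟩
  have hc0 : 0 < c := by rw [hc]; positivity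
  obtain ⟨K, hK⟩ : ∃ K : ℝ, K = Real.log Nt + Real.log (Real.Gamma Nt) - Nt * Real.log c := ⟨_, rfl⟩
  have hlim : ∀ C : ℝ, Filter.Tendsto (fun P : ℝ => (Nt:ℝ) + C / Real.log P) Filter.atTop
      (nhds (Nt : ℝ)) := by
    intro C
    simpa using (Real.tendsto_log_atTop.const_div_atTop C).const_add (Nt:ℝ)
  have key : ∀ P : ℝ, 1 < P → c ≤ P →
      (K + Nt * Real.log P ≤ -Real.log (FH (Qhat / (θ * P))) ∧
        -Real.log (FH (Qhat / (θ * P))) ≤ K + 1 + Nt * Real.log P) := by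
    intro P hP hcP
    have hP0 : 0 < P := by linarith
    obtain ⟨y, hy⟩ : ∃ y : ℝ, y = c / P := ⟨_, rfl⟩
    have hy0 : 0 < y := by rw [hy]; positivity
    have hy1 : y ≤ 1 := by rw [hy]; exact (div_le_one hP0).2 hcP
    have hly : Real.log y = Real.log c - Real.log P := by
      rw [hy, Real.log_div hc0.ne' hP0.ne']
    have hF : FH (Qhat / (θ * P)) = (Real.Gamma Nt - uiGamma Nt y) / Real.Gamma Nt := by
      rw [hFH, sub_div, div_self hG.ne', hy, hc]
      congr 3
      field_simp
    obtain ⟨h1, h2⟩ := aux_bounds Nt hNt y hy0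
    have hpos : 0 < Real.exp (-y) * (y ^ Nt / Nt) := by positivity
    have hD := lt_of_lt_of_le hpos h1
    have hl1 := Real.log_le_log hpos h1
    have hl2 := Real.log_le_log hD h2
    have hlp : Real.log (y ^ Nt / Nt) = Nt * Real.log y - Real.log Nt := by
      rw [Real.log_div (by positivity) hN0.ne', Real.log_pow]
    rw [Real.log_mul (by positivity) (by positivity), Real.log_exp] at hl1
    rw [hlp, hly] at hl1 hl2
    rw [hF, Real.log_div hD.ne' hG.ne', hK]
    constructor <;> linarith
  refine tendsto_of_tendsto_of_tendsto_of_le_of_le' (hlim K) (hlim (K + 1)) ?_ ?_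
  · filter_upwards [Filter.eventually_gt_atTop 1, Filter.eventually_ge_atTop c] with P hP hcP
    have hL := Real.log_pos hP
    rw [le_div_iff₀ hL, add_mul, div_mul_cancel₀ _ hL.ne']
    linarith [(key P hP hcP).1]
  · filter_upwards [Filter.eventually_gt_atTop 1, Filter.eventually_ge_atTop c] with P hP hcP
    have hL := Real.log_pos hP
    rw [div_le_iff₀ hL, add_mul, div_mul_cancel₀ _ hL.ne']
    linarith [(key P hP hcP).2]
end

section
/- Fix an integer N ≥ 1 and a real Ā > 0, and define ϑ(h) = h · Γ(N+1, N·Ā/h)/Γ(N+1) for h > 0. Then ϑ is a strictly increasing continuous bijection from (0, ∞) onto (0, ∞); letting h̄(c) denote the unique h > 0 with ϑ(h) = c, one has lim_{c→0⁺} h̄(c) · ln(1/c) = N·Ā. (This is the asymptotic (80) of the paper: the channel-power threshold below which per-block power outage occurs for threshold switching decays like N·Ā / ln(θP) as the transmit power P grows.) -/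
open MeasureTheory Set Filter Topology

lemma ug_int (α r : ℝ) (hα : 1 ≤ α) (hr : 0 < r) :
    IntegrableOn (fun t : ℝ => t ^ (α - 1) * Real.exp (-(r * t))) (Ioi 0) := by
  apply Integrable.of_integral_ne_zero
  rw [Real.integral_rpow_mul_exp_neg_mul_Ioi (by linarith) hr]
  have := Real.Gamma_pos_of_pos (show 0 < α by linarith)
  positivity

lemma ug_int1 (α : ℝ) (hα : 1 ≤ α) :
    IntegrableOn (fun t : ℝ => t ^ (α - 1) * Real.exp (-t)) (Ioi 0) := by
  simpa using ug_int α 1 hα one_pos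

lemma ug_zero (α : ℝ) (hα : 1 ≤ α) : uiGamma α 0 = Real.Gamma α := by
  have := Real.integral_rpow_mul_exp_neg_mul_Ioi (a := α) (r := 1) (by linarith) one_pos
  simpa [uiGamma] using this

lemma ug_sub (α : ℝ) (hα : 1 ≤ α) (x y : ℝ) (hx : 0 ≤ x) (hxy : x ≤ y) :
    uiGamma α x = (∫ t in x..y, t ^ (α - 1) * Real.exp (-t)) + uiGamma α y := by
  have h := ug_int1 α hα
  unfold uiGamma
  rw [intervalIntegral.integral_of_le hxy, ← setIntegral_union (Ioc_disjoint_Ioi le_rfl)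
    measurableSet_Ioi (h.mono_set (fun t ht => lt_of_le_of_lt hx ht.1))
    (h.mono_set (fun t ht => lt_of_le_of_lt (hx.trans hxy) ht)), Ioc_union_Ioi_eq_Ioi hxy]

lemma ug_cont_fun (α : ℝ) (hα : 1 ≤ α) :
    Continuous (fun t : ℝ => t ^ (α - 1) * Real.exp (-t)) := by
  have : Continuous (fun t : ℝ => t ^ (α - 1)) := Real.continuous_rpow_const (by linarith)
  fun_prop

lemma ug_anti (α : ℝ) (hα : 1 ≤ α) (x y : ℝ) (hx : 0 ≤ x) (hxy : x < y) :
    uiGamma α y < uiGamma α x := by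
  rw [ug_sub α hα x y hx hxy.le]
  have : 0 < ∫ t in x..y, t ^ (α - 1) * Real.exp (-t) := by
    apply intervalIntegral.intervalIntegral_pos_of_pos_on
      ((ug_cont_fun α hα).intervalIntegrable _ _) _ hxy
    intro t ht
    have : 0 < t := lt_of_le_of_lt hx ht.1
    positivity
  linarith

lemma ug_lower (α : ℝ) (hα : 1 ≤ α) (x : ℝ) (hx : 1 ≤ x) : Real.exp (-x) ≤ uiGamma α x := by
  rw [← integral_exp_neg_Ioi x]
  apply setIntegral_mono_on (integrableOn_exp_neg_Ioi x)
    ((ug_int1 α hα).mono_set (fun t (ht : x < t) => show 0 < t by linarith)) measurableSet_Ioi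
  intro t ht
  have ht : x < t := ht
  have : 1 ≤ t ^ (α - 1) := Real.one_le_rpow (by linarith) (by linarith)
  nlinarith [Real.exp_pos (-t)]

lemma ug_upper (α : ℝ) (hα : 1 ≤ α) (x : ℝ) (hx : 1 ≤ x) :
    uiGamma α x ≤ Real.exp (1 - x) * (x ^ α * Real.Gamma α) := by
  have hx0 : 0 < x := by linarith
  have hi := ug_int α (1 / x) hα (by positivity)
  have he := Real.integral_rpow_mul_exp_neg_mul_Ioi (a := α) (r := 1 / x) (by linarith)
    (by positivity)
  rw [one_div_one_div] at he
  rw [← he, ← integral_const_mul]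
  have hs : Ioi x ⊆ Ioi 0 := fun t (ht : x < t) => show 0 < t by linarith
  have hi2 := hi.const_mul (Real.exp (1 - x))
  refine le_trans (setIntegral_mono_on ((ug_int1 α hα).mono_set hs) (IntegrableOn.mono_set hi2 hs)
    measurableSet_Ioi ?_) (setIntegral_mono_set hi2 ?_ hs.eventuallyLE)
  · intro t ht
    have ht : x < t := ht
    have ht0 : 0 < t := by linarith
    have : Real.exp (-t) ≤ Real.exp (1 - x) * Real.exp (-(1 / x * t)) := by
      rw [← Real.exp_add]
      apply Real.exp_le_exp.2
      have h1 : 1 / x * t * x = t := by field_simp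
      have h2 : 1 < 1 / x * t := by
        rw [one_div, inv_mul_eq_div, one_lt_div hx0]; exact ht
      nlinarith
    have h3 : 0 ≤ t ^ (α - 1) := by positivity
    calc _ ≤ t ^ (α - 1) * (Real.exp (1 - x) * Real.exp (-(1 / x * t))) := by gcongr
      _ = _ := by ring
  · filter_upwards [ae_restrict_mem measurableSet_Ioi] with t ht
    have ht : 0 < t := ht
    simp only [Pi.zero_apply]
    positivity

lemma ug_pos (α : ℝ) (hα : 1 ≤ α) (x : ℝ) (hx : 0 ≤ x) : 0 < uiGamma α x := by
  have h1 := ug_anti α hα x (x + 1) hx (by linarith)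
  have h2 := ug_lower α hα (x + 1) (by linarith)
  have := Real.exp_pos (-(x + 1))
  linarith

lemma ug_le (α : ℝ) (hα : 1 ≤ α) (x : ℝ) (hx : 0 < x) : uiGamma α x < Real.Gamma α := by
  rw [← ug_zero α hα]
  exact ug_anti α hα 0 x le_rfl hx

lemma ug_cont (α : ℝ) (hα : 1 ≤ α) : ContinuousOn (uiGamma α) (Ici 0) := by
  have h : Continuous (fun x : ℝ => Real.Gamma α - ∫ t in (0:ℝ)..x, t ^ (α - 1) * Real.exp (-t)) :=
    continuous_const.sub (intervalIntegral.continuous_primitive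
      (fun a b => (ug_cont_fun α hα).intervalIntegrable a b) 0)
  refine h.continuousOn.congr ?_
  intro x hx
  have := ug_sub α hα 0 x le_rfl hx
  rw [ug_zero α hα] at this
  simp only
  linarith

/-- Asymptotic (80): `ϑ(h) = h·Γ(N+1, N·Ā/h)/Γ(N+1)` is a strictly increasing continuous
bijection of `(0, ∞)` onto itself, and its inverse `h̄` satisfies
`h̄(c)·ln(1/c) → N·Ā` as `c → 0⁺`. -/
theorem outage_threshold_asymptotics (N : ℕ) (hN : 1 ≤ N) (A : ℝ) (hA : 0 < A)
    (ϑ : ℝ → ℝ)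
    (hϑ : ∀ h : ℝ, ϑ h = h * uiGamma ((N : ℝ) + 1) ((N : ℝ) * A / h) / Real.Gamma ((N : ℝ) + 1)) :
    StrictMonoOn ϑ (Set.Ioi 0) ∧ ContinuousOn ϑ (Set.Ioi 0) ∧
    Set.BijOn ϑ (Set.Ioi 0) (Set.Ioi 0) ∧
    ∀ hbar : ℝ → ℝ, (∀ c : ℝ, 0 < c → 0 < hbar c ∧ ϑ (hbar c) = c) →
      Filter.Tendsto (fun c : ℝ => hbar c * Real.log (1 / c)) (nhdsWithin 0 (Set.Ioi 0))
        (nhds ((N : ℝ) * A)) := by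
  set α : ℝ := (N : ℝ) + 1 with hαd
  have hN0 : (1 : ℝ) ≤ N := by exact_mod_cast hN
  have hα : 1 ≤ α := by linarith
  set M : ℝ := (N : ℝ) * A with hM
  have hM0 : 0 < M := by positivity
  have hG : 0 < Real.Gamma α := Real.Gamma_pos_of_pos (by linarith)
  have hmono : StrictMonoOn ϑ (Ioi 0) := by
    intro a ha b hb hab
    have ha : 0 < a := ha
    have hb : 0 < b := hb
    rw [hϑ, hϑ]
    have h1 : M / b < M / a := by gcongr
    have h2 := ug_anti α hα (M / b) (M / a) (by positivity) h1
    have h3 := ug_pos α hα (M / a) (by positivity)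
    gcongr
  have hcont : ContinuousOn ϑ (Ioi 0) := by
    have : ϑ = fun h => h * uiGamma α (M / h) / Real.Gamma α := funext hϑ
    rw [this]
    refine ContinuousOn.div_const (continuousOn_id.mul ((ug_cont α hα).comp
      (continuousOn_const.div continuousOn_id ?_) ?_)) _
    · intro x hx; exact ne_of_gt hx
    · intro x hx
      have hx : 0 < x := hx
      exact (show 0 ≤ M / x by positivity)
  have hpos : ∀ h, 0 < h → 0 < ϑ h := by
    intro h hh
    rw [hϑ]
    have h3 := ug_pos α hα (M / h) (by positivity)
    positivity
  have hle : ∀ h, 0 < h → ϑ h ≤ h := by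
    intro h hh
    rw [hϑ, div_le_iff₀ hG]
    have h3 := ug_le α hα (M / h) (by positivity)
    gcongr
  have hsurj : SurjOn ϑ (Ioi 0) (Ioi 0) := by
    intro c hc
    have hc : 0 < c := hc
    have hg := ug_pos α hα M hM0.le
    set b : ℝ := max (max 1 c) (c * Real.Gamma α / uiGamma α M) with hb
    have hb1 : 1 ≤ b := (le_max_left _ _).trans (le_max_left _ _)
    have hbc : c ≤ b := (le_max_right _ _).trans (le_max_left _ _)
    have hb2 : c * Real.Gamma α / uiGamma α M ≤ b := le_max_right _ _
    have hb0 : 0 < b := by linarith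
    have hcb : c ≤ ϑ b := by
      rw [hϑ, le_div_iff₀ hG]
      rw [div_le_iff₀ hg] at hb2
      refine hb2.trans ?_
      have : uiGamma α M ≤ uiGamma α (M / b) := by
        rcases (div_le_self hM0.le hb1).lt_or_eq with h | h
        · exact (ug_anti α hα _ _ (by positivity) h).le
        · rw [h]
      gcongr
    have hsub : Icc c b ⊆ Ioi 0 := fun t ht => lt_of_lt_of_le hc ht.1
    obtain ⟨h, hh, he⟩ := intermediate_value_Icc hbc (hcont.mono hsub) ⟨hle c hc, hcb⟩
    exact ⟨h, hsub hh, he⟩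
  refine ⟨hmono, hcont, ⟨fun h hh => hpos h hh, hmono.injOn, hsurj⟩, ?_⟩
  intro hbar hb
  have hlim : Tendsto hbar (𝓝[>] 0) (𝓝[>] 0) := by
    refine tendsto_nhdsWithin_iff.2 ⟨?_, ?_⟩
    · rw [Metric.tendsto_nhds]
      intro ε hε
      filter_upwards [Ioo_mem_nhdsGT (hpos ε hε)] with c hc
      obtain ⟨h1, h2⟩ := hb c hc.1
      rw [Real.dist_eq, sub_zero, abs_of_pos h1]
      rw [← hmono.lt_iff_lt h1 hε, h2]
      exact hc.2
    · filter_upwards [self_mem_nhdsWithin] with c hc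
      exact (hb c hc).1
  have key : Tendsto (fun h => -(h * Real.log (ϑ h))) (𝓝[>] 0) (𝓝 M) := by
    have hid : Tendsto (fun h : ℝ => h) (𝓝[>] 0) (𝓝 0) := tendsto_nhdsWithin_of_tendsto_nhds tendsto_id
    have hlog : Tendsto (fun h : ℝ => h * Real.log h) (𝓝[>] 0) (𝓝 0) := by
      have := Real.continuous_mul_log.tendsto 0
      simp only [zero_mul] at this
      exact tendsto_nhdsWithin_of_tendsto_nhds this
    have hlo : Tendsto (fun h : ℝ => M + (α - 1) * (h * Real.log h) - h * (1 + α * Real.log M))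
        (𝓝[>] 0) (𝓝 M) := by
      simpa using ((hlog.const_mul (α - 1)).const_add M).sub (hid.mul_const (1 + α * Real.log M))
    have hhi : Tendsto (fun h : ℝ => M - h * Real.log h + h * Real.log (Real.Gamma α))
        (𝓝[>] 0) (𝓝 M) := by
      simpa using (hlog.const_sub M).add (hid.mul_const (Real.log (Real.Gamma α)))
    refine tendsto_of_tendsto_of_tendsto_of_le_of_le' hlo hhi ?_ ?_
    · filter_upwards [Ioo_mem_nhdsGT hM0] with h hh
      have h0 : 0 < h := hh.1
      have hx : 1 ≤ M / h := by rw [le_div_iff₀ h0]; linarith [hh.2]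
      have hu := ug_upper α hα (M / h) hx
      have hx0 : 0 < M / h := by positivity
      have hle2 : ϑ h ≤ h * (Real.exp (1 - M / h) * (M / h) ^ α) := by
        rw [hϑ, div_le_iff₀ hG]
        calc _ ≤ h * (Real.exp (1 - M / h) * ((M / h) ^ α * Real.Gamma α)) := by gcongr
          _ = _ := by ring
      have hl := Real.log_le_log (hpos h h0) hle2
      have hxa : 0 < (M / h) ^ α := Real.rpow_pos_of_pos hx0 _
      rw [Real.log_mul h0.ne' (by positivity), Real.log_mul (Real.exp_pos _).ne' hxa.ne',
        Real.log_exp, Real.log_rpow hx0, Real.log_div hM0.ne' h0.ne'] at hl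
      have h4 := mul_le_mul_of_nonneg_left hl h0.le
      have h5 : h * (M / h) = M := by field_simp
      linarith
    · filter_upwards [Ioo_mem_nhdsGT hM0] with h hh
      have h0 : 0 < h := hh.1
      have hx : 1 ≤ M / h := by rw [le_div_iff₀ h0]; linarith [hh.2]
      have hu := ug_lower α hα (M / h) hx
      have hle2 : h * Real.exp (-(M / h)) / Real.Gamma α ≤ ϑ h := by
        rw [hϑ]
        gcongr
      have hl := Real.log_le_log (by positivity) hle2
      rw [Real.log_div (by positivity) hG.ne', Real.log_mul h0.ne' (Real.exp_pos _).ne',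
        Real.log_exp] at hl
      have h4 := mul_le_mul_of_nonneg_left hl h0.le
      have h5 : h * (M / h) = M := by field_simp
      linarith
  refine (key.comp hlim).congr' ?_
  filter_upwards [self_mem_nhdsWithin] with c hc
  simp only [Function.comp, (hb c hc).2, one_div, Real.log_inv]
  ring
end

section
/- Fix integers N, Nt with 1 ≤ N ≤ Nt, a real Ā > 0, and constants Q̂ > 0, θ > 0. Let ϑ(h) = h · Γ(N+1, N·Ā/h)/Γ(N+1) for h > 0, let h̄(c) be the unique h > 0 with ϑ(h) = c, and let F_H(x) = 1 − Γ(Nt, Nt·x)/Γ(Nt). Then the power outage probability p(P) = F_H( h̄( Q̂/(θ·P) ) ) satisfies p(P) → 0 as P → ∞, yet lim_{P→∞} ( −ln(p(P)) / ln(P) ) = 0. (Proposition 3.3, case Ā > 0: the power diversity order of threshold switching with a fixed positive threshold is zero.) -/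
open Set Filter MeasureTheory Topology

lemma uiG_eq (m : ℕ) (x : ℝ) : uiGamma ((m : ℝ) + 1) x = ∫ t in Ioi x, t ^ m * Real.exp (-t) := by
  unfold uiGamma
  simp [Real.rpow_natCast]

lemma gam_eq (m : ℕ) : Real.Gamma ((m : ℝ) + 1) = ∫ t in Ioi (0 : ℝ), t ^ m * Real.exp (-t) := by
  rw [Real.Gamma_eq_integral (by positivity)]
  simp [Real.rpow_natCast, mul_comm]

lemma integ (m : ℕ) : IntegrableOn (fun t : ℝ => t ^ m * Real.exp (-t)) (Ioi 0) := by
  have := Real.GammaIntegral_convergent (s := (m : ℝ) + 1) (by positivity)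
  simpa [Real.rpow_natCast, mul_comm] using this

lemma uiG_anti (m : ℕ) {x y : ℝ} (hx : 0 ≤ x) (hxy : x ≤ y) :
    uiGamma ((m : ℝ) + 1) y ≤ uiGamma ((m : ℝ) + 1) x := by
  rw [uiG_eq, uiG_eq]
  refine setIntegral_mono_set ((integ m).mono_set (Ioi_subset_Ioi hx)) ?_
    (Ioi_subset_Ioi hxy).eventuallyLE
  filter_upwards [ae_restrict_mem measurableSet_Ioi] with t ht
  have : 0 < t := lt_of_le_of_lt hx ht
  simp only [Pi.zero_apply]
  positivity

lemma uiG_pos (m : ℕ) {x : ℝ} (hx : 0 ≤ x) : 0 < uiGamma ((m : ℝ) + 1) x := by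
  rw [uiG_eq]
  rw [setIntegral_pos_iff_support_of_nonneg_ae]
  · have : Ioi x ⊆ Function.support (fun t : ℝ => t ^ m * Real.exp (-t)) := by
      intro t ht
      have : 0 < t := lt_of_le_of_lt hx ht
      simp only [Function.mem_support]
      positivity
    rw [inter_eq_self_of_subset_right this]
    simp
  · filter_upwards [ae_restrict_mem measurableSet_Ioi] with t ht
    have : 0 < t := lt_of_le_of_lt hx ht
    simp only [Pi.zero_apply]
    positivity
  · exact (integ m).mono_set (Ioi_subset_Ioi hx)

lemma uiG_le (m : ℕ) {x : ℝ} (hx : 0 ≤ x) :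
    uiGamma ((m : ℝ) + 1) x ≤ 2 * (2 ^ m * m.factorial) * Real.exp (-(1 / 2) * x) := by
  rw [uiG_eq]
  have h1 : IntegrableOn (fun t : ℝ => (2 ^ m * m.factorial : ℝ) * Real.exp (-(1 / 2) * t)) (Ioi x) :=
    (integrableOn_exp_mul_Ioi (by norm_num) x).const_mul _
  calc _ ≤ ∫ t in Ioi x, (2 ^ m * m.factorial : ℝ) * Real.exp (-(1 / 2) * t) := by
        refine setIntegral_mono_on ((integ m).mono_set (Ioi_subset_Ioi hx)) h1 measurableSet_Ioi ?_
        intro t ht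
        have ht0 : 0 < t := lt_of_le_of_lt hx ht
        have h2 := Real.pow_div_factorial_le_exp (t / 2) (by positivity) m
        have h3 : t ^ m ≤ (2 ^ m * m.factorial : ℝ) * Real.exp (t / 2) := by
          rw [div_pow, div_div, div_le_iff₀ (by positivity)] at h2
          linarith
        calc t ^ m * Real.exp (-t) ≤ ((2 ^ m * m.factorial : ℝ) * Real.exp (t / 2)) * Real.exp (-t) := by
              gcongr
          _ = _ := by
              rw [mul_assoc, ← Real.exp_add]; congr 2; ring
    _ = _ := by
        rw [integral_const_mul, integral_exp_mul_Ioi (by norm_num)]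
        ring

lemma lower_eq (m : ℕ) {y : ℝ} (hy : 0 ≤ y) :
    Real.Gamma ((m : ℝ) + 1) - uiGamma ((m : ℝ) + 1) y = ∫ t in (0 : ℝ)..y, t ^ m * Real.exp (-t) := by
  rw [gam_eq, uiG_eq]
  exact (intervalIntegral.integral_Ioi_sub_Ioi (integ m) hy)

lemma lower_le (m : ℕ) {y : ℝ} (hy : 0 ≤ y) :
    Real.Gamma ((m : ℝ) + 1) - uiGamma ((m : ℝ) + 1) y ≤ y ^ (m + 1) := by
  rw [lower_eq m hy]
  have : ∫ t in (0 : ℝ)..y, t ^ m * Real.exp (-t) ≤ ∫ t in (0 : ℝ)..y, y ^ m := by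
    refine intervalIntegral.integral_mono_on hy ?_ ?_ ?_
    · exact Continuous.intervalIntegrable (by fun_prop) _ _
    · exact Continuous.intervalIntegrable (by fun_prop) _ _
    · intro t ht
      calc t ^ m * Real.exp (-t) ≤ y ^ m * 1 := by
            have := ht.1
            gcongr
            · exact ht.2
            · exact Real.exp_le_one_iff.2 (by linarith)
        _ = _ := mul_one _
  refine this.trans (le_of_eq ?_)
  simp; ring

lemma le_lower (m : ℕ) {y : ℝ} (hy : 0 ≤ y) (hy1 : y ≤ 1) :
    Real.exp (-1) / (m + 1) * y ^ (m + 1) ≤ Real.Gamma ((m : ℝ) + 1) - uiGamma ((m : ℝ) + 1) y := by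
  rw [lower_eq m hy]
  have : ∫ t in (0 : ℝ)..y, t ^ m * Real.exp (-1) ≤ ∫ t in (0 : ℝ)..y, t ^ m * Real.exp (-t) := by
    refine intervalIntegral.integral_mono_on hy ?_ ?_ ?_
    · exact Continuous.intervalIntegrable (by fun_prop) _ _
    · exact Continuous.intervalIntegrable (by fun_prop) _ _
    · intro t ht
      have := ht.1
      have := ht.2
      gcongr
      linarith
  refine le_trans (le_of_eq ?_) this
  simp; ring

/-- Proposition 3.3 (case `Ā > 0`): the power outage probability
`p(P) = F_H(h̄(Q̂/(θP)))` of threshold switching with a fixed positive threshold tends to `0` as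
`P → ∞`, yet the power diversity order `lim −ln(p(P))/ln(P)` is zero. -/
theorem power_diversity_order_zero (N Nt : ℕ) (hN : 1 ≤ N) (hNNt : N ≤ Nt)
    (A Qhat θ : ℝ) (hA : 0 < A) (hQhat : 0 < Qhat) (hθ : 0 < θ)
    (ϑ : ℝ → ℝ)
    (hϑ : ∀ h : ℝ, ϑ h = h * uiGamma ((N : ℝ) + 1) ((N : ℝ) * A / h) / Real.Gamma ((N : ℝ) + 1))
    (hbar : ℝ → ℝ) (hhbar : ∀ c : ℝ, 0 < c → 0 < hbar c ∧ ϑ (hbar c) = c)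
    (FH : ℝ → ℝ)
    (hFH : ∀ x : ℝ, FH x = 1 - uiGamma Nt ((Nt : ℝ) * x) / Real.Gamma Nt)
    (p : ℝ → ℝ) (hp : ∀ P : ℝ, p P = FH (hbar (Qhat / (θ * P)))) :
    Filter.Tendsto p Filter.atTop (nhds 0) ∧
    Filter.Tendsto (fun P : ℝ => -Real.log (p P) / Real.log P) Filter.atTop (nhds 0) := by
  obtain ⟨m, rfl⟩ : ∃ m, Nt = m + 1 := ⟨Nt - 1, by omega⟩
  have hNpos : (0 : ℝ) < N := by exact_mod_cast hN
  have hΓN : 0 < Real.Gamma ((N : ℝ) + 1) := Real.Gamma_pos_of_pos (by positivity)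
  have hΓ : 0 < Real.Gamma ((m : ℝ) + 1) := Real.Gamma_pos_of_pos (by positivity)
  set H : ℝ → ℝ := fun P => hbar (Qhat / (θ * P)) with hH
  have hc : ∀ P : ℝ, 0 < P → 0 < H P ∧ ϑ (H P) = Qhat / (θ * P) := fun P hP =>
    hhbar _ (by positivity)
  have hpos : ∀ᶠ P in atTop, 0 < H P := by
    filter_upwards [eventually_gt_atTop 0] with P hP using (hc P hP).1
  have hc0 : Tendsto (fun P : ℝ => Qhat / (θ * P)) atTop (𝓝 0) :=
    tendsto_const_nhds.div_atTop (tendsto_id.const_mul_atTop hθ)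
  have hsmall : ∀ ε : ℝ, 0 < ε → ∀ᶠ P in atTop, H P < ε := by
    intro ε hε
    have h1 : 0 < ε * uiGamma ((N : ℝ) + 1) (N * A / ε) / Real.Gamma ((N : ℝ) + 1) := by
      have := uiG_pos N (x := N * A / ε) (by positivity)
      positivity
    filter_upwards [eventually_gt_atTop 0, hc0.eventually_lt_const h1] with P hP hlt
    by_contra! hcon
    obtain ⟨h2, h3⟩ := hc P hP
    rw [← h3, hϑ] at hlt
    refine absurd hlt (not_lt.2 ?_)
    have h4 : uiGamma ((N : ℝ) + 1) (N * A / ε) ≤ uiGamma ((N : ℝ) + 1) (N * A / H P) :=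
      uiG_anti N (by positivity) (by gcongr)
    have := uiG_pos N (x := N * A / ε) (by positivity)
    gcongr
  have hH0 : Tendsto H atTop (𝓝 0) := by
    rw [tendsto_order]
    refine ⟨fun a ha => ?_, fun a ha => hsmall a ha⟩
    filter_upwards [hpos] with P hP using ha.trans hP
  have hpe : ∀ P, p P = (Real.Gamma ((m : ℝ) + 1) - uiGamma ((m : ℝ) + 1) (((m : ℝ) + 1) * H P))
      / Real.Gamma ((m : ℝ) + 1) := by
    intro P
    rw [hp, hFH, sub_div, div_self (by push_cast; exact hΓ.ne')]
    push_cast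
    rfl
  set D : ℝ := Real.exp (-1) / (m + 1) * ((m : ℝ) + 1) ^ (m + 1) / Real.Gamma ((m : ℝ) + 1) with hD
  have hDpos : 0 < D := by positivity
  have hlow : ∀ᶠ P in atTop, D * H P ^ (m + 1) ≤ p P := by
    filter_upwards [hpos, hsmall (1 / ((m : ℝ) + 1)) (by positivity)] with P h1 h2
    rw [lt_div_iff₀ (by positivity)] at h2
    have := le_lower m (y := ((m : ℝ) + 1) * H P) (by positivity) (by linarith)
    rw [hpe, le_div_iff₀ hΓ]
    refine le_trans (le_of_eq ?_) this
    rw [hD, mul_pow]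
    field_simp
  have hp0 : Tendsto p atTop (𝓝 0) := by
    have hup : Tendsto (fun P => (((m : ℝ) + 1) * H P) ^ (m + 1) / Real.Gamma ((m : ℝ) + 1))
        atTop (𝓝 0) := by
      have := ((hH0.const_mul ((m : ℝ) + 1)).pow (m + 1)).div_const (Real.Gamma ((m : ℝ) + 1))
      simpa using this
    refine tendsto_of_tendsto_of_tendsto_of_le_of_le' tendsto_const_nhds hup ?_ ?_
    · filter_upwards [hlow, hpos] with P h1 h2
      exact le_trans (by positivity) h1
    · filter_upwards [hpos] with P h1
      rw [hpe]
      have := lower_le m (y := ((m : ℝ) + 1) * H P) (by positivity)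
      gcongr
  refine ⟨hp0, ?_⟩
  -- the reciprocal of the threshold power
  set a : ℝ := N * A / 2 with ha
  have hapos : 0 < a := by positivity
  have hu : Tendsto (fun P => (H P)⁻¹) atTop atTop := by
    refine Tendsto.comp tendsto_inv_nhdsGT_zero ?_
    exact tendsto_nhdsWithin_iff.2 ⟨hH0, hpos⟩
  set K : ℝ := 2 * (2 ^ N * N.factorial) / Real.Gamma ((N : ℝ) + 1) with hK
  have hKpos : 0 < K := by positivity
  set b : ℝ := Real.log (K * θ / Qhat) with hb
  have hlogP : ∀ᶠ P in atTop, a * (H P)⁻¹ - b ≤ Real.log P := by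
    filter_upwards [hpos, hsmall 1 one_pos, eventually_gt_atTop 0] with P h1 h2 hP
    have h3 := (hc P hP).2
    rw [hϑ] at h3
    have h4 := uiG_le N (x := N * A / H P) (by positivity)
    have h5 : Qhat / (θ * P) ≤ K * Real.exp (-(a * (H P)⁻¹)) := by
      rw [← h3]
      have h6 := uiG_pos N (x := N * A / H P) (by positivity)
      calc _ ≤ 1 * (2 * (2 ^ N * N.factorial) * Real.exp (-(1 / 2) * (N * A / H P)))
            / Real.Gamma ((N : ℝ) + 1) := by gcongr
        _ = _ := by
          have : -(1 / 2) * (N * A / H P) = -(a * (H P)⁻¹) := by rw [ha]; ring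
          rw [this, hK]; ring
    have h7 : Real.exp (a * (H P)⁻¹) ≤ (K * θ / Qhat) * P := by
      rw [Real.exp_neg, div_le_iff₀ (by positivity)] at h5
      have h8 := Real.exp_pos (a * (H P)⁻¹)
      rw [div_mul_eq_mul_div (K * θ), le_div_iff₀ hQhat]
      calc _ ≤ Real.exp (a * (H P)⁻¹) * (K * (Real.exp (a * (H P)⁻¹))⁻¹ * (θ * P)) := by gcongr
        _ = _ := by field_simp
    have h9 := Real.log_le_log (Real.exp_pos _) h7
    rw [Real.log_exp, Real.log_mul (by positivity) hP.ne'] at h9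
    linarith
  have hlogP2 : ∀ᶠ P in atTop, a / 2 * (H P)⁻¹ ≤ Real.log P := by
    filter_upwards [hlogP, (hu.const_mul_atTop (half_pos hapos)).eventually_ge_atTop b] with P h1 h2
    linarith
  have hnum : Tendsto (fun P => (|Real.log D| + ((m : ℝ) + 1) * Real.log (H P)⁻¹)
      / (a / 2 * (H P)⁻¹)) atTop (𝓝 0) := by
    have h1 : Tendsto (fun u : ℝ => (|Real.log D| + ((m : ℝ) + 1) * Real.log u) / (a / 2 * u))
        atTop (𝓝 0) := by
      have e1 : Tendsto (fun u : ℝ => |Real.log D| / (a / 2 * u)) atTop (𝓝 0) :=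
        tendsto_const_nhds.div_atTop (tendsto_id.const_mul_atTop (half_pos hapos))
      have e2 : Tendsto (fun u : ℝ => Real.log u / u) atTop (𝓝 0) :=
        Real.isLittleO_log_id_atTop.tendsto_div_nhds_zero
      have e3 := e1.add (e2.const_mul (((m : ℝ) + 1) / (a / 2)))
      rw [mul_zero, add_zero] at e3
      refine e3.congr fun u => ?_
      rw [div_mul_div_comm, ← add_div]
    exact h1.comp hu
  refine tendsto_of_tendsto_of_tendsto_of_le_of_le' tendsto_const_nhds hnum ?_ ?_
  · filter_upwards [hp0.eventually_le_const one_pos, hlow, hpos, eventually_ge_atTop 1]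
      with P h1 h2 h3 h4
    have h5 : 0 ≤ p P := le_trans (by positivity) h2
    exact div_nonneg (neg_nonneg.2 (Real.log_nonpos h5 h1)) (Real.log_nonneg h4)
  · filter_upwards [hlow, hpos, hsmall 1 one_pos, hlogP2] with P h2 h3 h4 h5
    have h6 : Real.log (D * H P ^ (m + 1)) ≤ Real.log (p P) :=
      Real.log_le_log (by positivity) h2
    rw [Real.log_mul (by positivity) (by positivity), Real.log_pow] at h6
    push_cast at h6
    have h7 : 0 ≤ Real.log (H P)⁻¹ := Real.log_nonneg ((one_le_inv₀ h3).2 h4.le)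
    have h8 : -Real.log (p P) ≤ |Real.log D| + ((m : ℝ) + 1) * Real.log (H P)⁻¹ := by
      rw [Real.log_inv]
      have := neg_abs_le (Real.log D)
      linarith
    have h9 : 0 < a / 2 * (H P)⁻¹ := by positivity
    exact div_le_div₀ (by positivity) h8 h9 h5
end

section
/- Fix reals θ > 0, P > 0, Ā ≥ 0 and Q̂ > 0, and define the per-block harvested power of the unitary-random-beam threshold-switching scheme by Q(h) = θ·P·(h − Ā²/(4h)) if h ≥ Ā/2 and Q(h) = 0 if 0 < h < Ā/2. Then for every h > 0: Q(h) < Q̂ if and only if h < ( Q̂ + √(Q̂² + θ²·P²·Ā²) ) / (2·θ·P). Consequently, if the normalized channel power H has CDF F_H, the power outage probability Pr(Q(H) < Q̂) equals F_H( ( Q̂ + √(Q̂² + θ²·P²·Ā²) ) / (2·θ·P) ). (This is equation (42) of the paper, for TS with a unitary random beam, Nt = 2 and N = 1.) -/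
open MeasureTheory

/-- Equation (42): for TS with a unitary random beam (`Nt = 2`, `N = 1`), the per-block harvested
power `Q(h) = θP(h − Ā²/(4h))` for `h ≥ Ā/2` (and `0` otherwise) falls below the target `Q̂` iff
`h < (Q̂ + √(Q̂² + θ²P²Ā²))/(2θP)`; consequently the power outage probability equals the CDF of
the normalized channel power evaluated at this point. -/
theorem unitary_beam_power_outage (θ P A Qhat : ℝ)
    (hθ : 0 < θ) (hP : 0 < P) (hA : 0 ≤ A) (hQhat : 0 < Qhat)
    (Q : ℝ → ℝ)
    (hQ : ∀ h : ℝ, Q h = if A / 2 ≤ h then θ * P * (h - A ^ 2 / (4 * h)) else 0) :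
    (∀ h : ℝ, 0 < h →
      (Q h < Qhat ↔
        h < (Qhat + Real.sqrt (Qhat ^ 2 + θ ^ 2 * P ^ 2 * A ^ 2)) / (2 * θ * P))) ∧
    ∀ (Ω : Type) (_ : MeasurableSpace Ω) (μ : Measure Ω), IsProbabilityMeasure μ →
      ∀ H : Ω → ℝ, (∀ ω : Ω, 0 < H ω) →
        μ {ω : Ω | Q (H ω) < Qhat} =
          μ {ω : Ω |
            H ω < (Qhat + Real.sqrt (Qhat ^ 2 + θ ^ 2 * P ^ 2 * A ^ 2)) / (2 * θ * P)} := by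
  have key : ∀ h : ℝ, 0 < h →
      (Q h < Qhat ↔
        h < (Qhat + Real.sqrt (Qhat ^ 2 + θ ^ 2 * P ^ 2 * A ^ 2)) / (2 * θ * P)) := by
    intro h hh
    have hc : 0 < θ * P := mul_pos hθ hP
    have hrad : 0 ≤ Qhat ^ 2 + θ ^ 2 * P ^ 2 * A ^ 2 := by positivity
    have hS0 := Real.sqrt_nonneg (Qhat ^ 2 + θ ^ 2 * P ^ 2 * A ^ 2)
    have hS := Real.sq_sqrt hrad
    set S := Real.sqrt (Qhat ^ 2 + θ ^ 2 * P ^ 2 * A ^ 2) with hSdef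
    have hSQ : Qhat ≤ S := Real.le_sqrt_of_sq_le (le_add_of_nonneg_right (by positivity))
    have hSA : θ * P * A ≤ S := Real.le_sqrt_of_sq_le (by nlinarith [sq_nonneg Qhat])
    rw [hQ, lt_div_iff₀ (by positivity)]
    split_ifs with hcase
    · have e : Qhat - θ * P * (h - A ^ 2 / (4 * h))
          = (S ^ 2 - (2 * (θ * P) * h - Qhat) ^ 2) / (4 * h * (θ * P)) := by
        rw [hS]
        field_simp
        ring
      have hpos : 0 < 2 * (θ * P) * h := by positivity
      rw [← sub_pos, e, div_pos_iff_of_pos_right (by positivity), sub_pos, sq_lt_sq,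
        abs_of_nonneg hS0, abs_lt]
      constructor
      · rintro ⟨_, h2⟩
        linarith
      · intro h2
        constructor <;> linarith
    · push Not at hcase
      have h1 : θ * P * h < θ * P * (A / 2) := mul_lt_mul_of_pos_left hcase hc
      constructor
      · intro _
        linarith
      · intro _
        exact hQhat
  refine ⟨key, ?_⟩
  intro Ω _ μ _ H hH
  congr 1
  ext ω
  exact key (H ω) (hH ω)
end
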